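/- arXiv:1711.02362 — 4 statements merged into one kernel-verified Lean document; each statement's English description precedes it below -/
import Mathlib

section
/- For the function g(ζ) = (2/(πa)) ∫_0^a ln(ζ − s) √((a−s)/s) ds, analytic on ℂ \ (−∞, a] for a > 0, one has the closed-form identity g(ζ) = −(2/a)√(ζ(ζ−a)) − ln a + ln(2ζ − a + 2√(ζ(ζ−a))) + 2ζ/a + ln(a/(4e)), valid for ζ in ℂ \ (−∞, a]. -/
open Complex

/-- The branch of `√(ζ(ζ - a))` with cut `[0, a]` that behaves like `ζ` as `ζ → +∞`. -/
noncomputable def sqrtBranch (a : ℝ) (ζ : ℂ) : ℂ :=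
  ζ * (1 - (a : ℂ) / ζ) ^ ((1 : ℂ) / 2)

lemma aux_slit {q z : ℂ} (hq : ‖q‖ < 1) (hz : ‖z‖ ≤ 1) : 0 < (1 + q * z).re := by
  have h1 : ‖q * z‖ < 1 := by
    rw [norm_mul]
    calc ‖q‖ * ‖z‖ ≤ ‖q‖ * 1 := by gcongr
      _ < 1 := by simpa using hq
  have h2 := abs_lt.1 ((abs_re_le_norm (q * z)).trans_lt h1)
  rw [add_re, one_re]
  linarith [h2.1]

lemma aux_circle (q : ℂ) (hq : ‖q‖ < 1) :
    ∫ θ in (0 : ℝ)..(2 * Real.pi),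
      Complex.log (1 + q * exp (θ * I)) * (1 + (Real.cos θ : ℂ)) = Real.pi * q := by
  set f : ℂ → ℂ := fun z => Complex.log (1 + q * z) with hf
  set U : Set ℂ := {z | 1 + q * z ∈ slitPlane} with hU
  have hUo : IsOpen U := isOpen_slitPlane.preimage (by fun_prop)
  have hsub : Metric.closedBall (0 : ℂ) 1 ⊆ U := by
    intro z hz
    exact Or.inl (aux_slit hq (by simpa using hz))
  have h0 : (0 : ℂ) ∈ U := hsub (by simp)
  have hfd : DifferentiableOn ℂ f U := by
    intro z hz
    apply DifferentiableAt.differentiableWithinAt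
    exact DifferentiableAt.clog (by fun_prop) hz
  have hdd : DifferentiableOn ℂ (dslope f 0) U :=
    (Complex.differentiableOn_dslope (hUo.mem_nhds h0)).2 hfd
  set K : ℂ → ℂ := fun z => f z + (z * f z + dslope f 0 z) / 2 with hK
  have hKd : DifferentiableOn ℂ K U := by
    apply hfd.add
    exact ((differentiableOn_id.mul hfd).add hdd).div_const 2
  have hdc : DiffContOnCl ℂ K (Metric.ball 0 |1|) := by
    apply DifferentiableOn.diffContOnCl
    apply hKd.mono
    rw [abs_one, closure_ball _ one_ne_zero]
    exact hsub
  have havg := hdc.circleAverage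
  have hder : HasDerivAt f q 0 := by
    have h1 : HasDerivAt (fun z : ℂ => 1 + q * z) q 0 := by
      simpa using ((hasDerivAt_id (0 : ℂ)).const_mul q).const_add 1
    simpa using h1.clog h0
  have hK0 : K 0 = q / 2 := by
    have h := hder.deriv
    simp only [hK, dslope_same, h]
    simp [hf]
  rw [hK0, Real.circleAverage_def] at havg
  have hcongr : ∀ θ : ℝ, K (circleMap 0 1 θ) =
      Complex.log (1 + q * exp (θ * I)) * (1 + (Real.cos θ : ℂ)) := by
    intro θ
    have hne : exp (θ * I) ≠ 0 := exp_ne_zero _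
    have hf0 : f 0 = 0 := by simp [hf]
    have hcos : (Real.cos θ : ℂ) = (exp (θ * I) + (exp (θ * I))⁻¹) / 2 := by
      rw [ofReal_cos, Complex.cos, ← Complex.exp_neg, neg_mul]
    simp only [hK, circleMap, ofReal_one, one_mul, zero_add]
    rw [dslope_of_ne _ hne, slope_def_field, hf0, hcos]
    simp only [hf]
    field_simp
    ring
  simp only [hcongr] at havg
  have hpi : (Real.pi : ℂ) ≠ 0 := by exact_mod_cast Real.pi_ne_zero
  rw [Complex.real_smul] at havg
  push_cast at havg ⊢
  rw [inv_mul_eq_iff_eq_mul₀ (by simpa using hpi)] at havg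
  rw [havg]; ring

lemma aux_cont (q : ℂ) (hq : ‖q‖ < 1) : Continuous (fun θ : ℝ =>
      Complex.log (1 + q * exp (θ * I)) * (1 + (Real.cos θ : ℂ))) := by
  apply Continuous.mul
  · apply Continuous.clog (by fun_prop)
    intro θ
    exact Or.inl (aux_slit hq (by rw [norm_exp_ofReal_mul_I]))
  · fun_prop

lemma aux_half (q : ℂ) (hq : ‖q‖ < 1) :
    ∫ θ in (0 : ℝ)..Real.pi,
      (Complex.log (1 + q * exp (θ * I)) + Complex.log (1 + q * exp (-(θ * I))))
        * (1 + (Real.cos θ : ℂ)) = Real.pi * q := by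
  have hc := aux_cont q hq
  set F : ℝ → ℂ := (fun θ : ℝ =>
      Complex.log (1 + q * exp (θ * I)) * (1 + (Real.cos θ : ℂ))) with hF
  have h1 : ∀ θ : ℝ, (Complex.log (1 + q * exp (θ * I)) + Complex.log (1 + q * exp (-(θ * I))))
        * (1 + (Real.cos θ : ℂ)) = F θ + F (2 * Real.pi - θ) := by
    intro θ
    have : exp (((2 * Real.pi - θ : ℝ) : ℂ) * I) = exp (-(θ * I)) := by
      push_cast
      rw [show (2 * (Real.pi : ℂ) - θ) * I = -(θ * I) + 2 * Real.pi * I by ring,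
        Complex.exp_periodic]
    simp only [hF]
    rw [this, Real.cos_two_pi_sub]
    ring
  simp only [h1]
  have hc2 : Continuous (fun θ => F (2 * Real.pi - θ)) := hc.comp (by fun_prop)
  rw [intervalIntegral.integral_add (hc.intervalIntegrable _ _) (hc2.intervalIntegrable _ _),
    intervalIntegral.integral_comp_sub_left (fun x => F x)]
  rw [show 2 * Real.pi - Real.pi = Real.pi by ring, sub_zero,
    intervalIntegral.integral_add_adjacent_intervals (hc.intervalIntegrable _ _)
      (hc.intervalIntegrable _ _)]
  exact aux_circle q hq

lemma aux_subst (a : ℝ) (ha : 0 < a) (h : ℝ → ℂ) :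
    ∫ s in (0 : ℝ)..a, h s * (Real.sqrt ((a - s) / s) : ℂ) =
    ∫ θ in (0 : ℝ)..Real.pi, (a / 2 : ℂ) * (h (a * (1 - Real.cos θ) / 2) *
      (1 + (Real.cos θ : ℂ))) := by
  have himg : (fun θ : ℝ => a * (1 - Real.cos θ) / 2) '' Set.Ioo 0 Real.pi = Set.Ioo 0 a := by
    ext s
    constructor
    · rintro ⟨θ, ⟨h0, h1⟩, rfl⟩
      have e1 : Real.cos θ < 1 := by
        have := Real.cos_lt_cos_of_nonneg_of_le_pi le_rfl h1.le h0
        simpa using this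
      have e2 : -1 < Real.cos θ := by
        have := Real.cos_lt_cos_of_nonneg_of_le_pi h0.le le_rfl h1
        simpa using this
      constructor
      · dsimp only; have : 0 < 1 - Real.cos θ := by linarith
        positivity
      · dsimp only; nlinarith
    · rintro ⟨h0, h1⟩
      have hs : 0 < s / a := by positivity
      have hs' : s / a < 1 := by rw [div_lt_one ha]; exact h1
      refine ⟨Real.arccos (1 - 2 * (s / a)), ⟨Real.arccos_pos.2 (by linarith), ?_⟩, ?_⟩
      · refine lt_of_le_of_ne (Real.arccos_le_pi _) ?_
        rw [Ne, Real.arccos_eq_pi]; linarith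
      · dsimp only
        rw [Real.cos_arccos (by linarith) (by linarith)]
        field_simp; ring
  rw [intervalIntegral.integral_of_le ha.le, intervalIntegral.integral_of_le Real.pi_pos.le,
    MeasureTheory.integral_Ioc_eq_integral_Ioo, MeasureTheory.integral_Ioc_eq_integral_Ioo,
    ← himg, MeasureTheory.integral_image_eq_integral_abs_deriv_smul
      (f' := fun θ => a * Real.sin θ / 2) measurableSet_Ioo]
  · apply MeasureTheory.setIntegral_congr_fun measurableSet_Ioo
    rintro θ ⟨h0, h1⟩
    have hs : 0 < Real.sin θ := Real.sin_pos_of_pos_of_lt_pi h0 h1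
    have hsq := Real.sin_sq_add_cos_sq θ
    have hc1 : 0 ≤ 1 + Real.cos θ := by linarith [Real.neg_one_le_cos θ]
    have hc2 : 0 < 1 - Real.cos θ := by
      have : Real.cos θ < 1 := by
        have := Real.cos_lt_cos_of_nonneg_of_le_pi le_rfl h1.le h0
        simpa using this
      linarith
    have e : (a - a * (1 - Real.cos θ) / 2) / (a * (1 - Real.cos θ) / 2)
        = ((1 + Real.cos θ) / Real.sin θ) ^ 2 := by
      rw [div_pow, div_eq_div_iff (by positivity) (by positivity)]
      rw [show Real.sin θ ^ 2 = 1 - Real.cos θ ^ 2 by linarith]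
      ring
    dsimp only
    rw [e, Real.sqrt_sq (by positivity), abs_of_pos (by positivity), Complex.real_smul]
    have hs' : (Real.sin θ : ℂ) ≠ 0 := by exact_mod_cast hs.ne'
    push_cast at hs' ⊢
    field_simp
  · intro θ _
    apply HasDerivAt.hasDerivWithinAt
    have := (((Real.hasDerivAt_cos θ).const_sub 1).const_mul a).div_const 2
    simpa using this
  · intro x hx y hy hxy
    apply Real.injOn_cos (Set.Ioo_subset_Icc_self hx) (Set.Ioo_subset_Icc_self hy)
    dsimp only at hxy
    have : a * (Real.cos x - Real.cos y) = 0 := by linarith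
    rcases mul_eq_zero.1 this with h | h
    · exact absurd h ha.ne'
    · linarith

/-- branch bookkeeping -/
lemma aux_log_div (p q : ℂ) (hp : p ∈ slitPlane) (hq : q ∈ slitPlane)
    (h0 : q.im = 0 → 0 < q.re)
    (h1 : 0 < q.im → (p * q⁻¹).im < 0) (h2 : q.im < 0 → 0 < (p * q⁻¹).im) :
    Complex.log (p * q⁻¹) = Complex.log p + Complex.log q⁻¹ := by
  have hp0 := slitPlane_ne_zero hp
  have hq0 := slitPlane_ne_zero hq
  have hqpi := slitPlane_arg_ne_pi hq
  have hppi := slitPlane_arg_ne_pi hp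
  apply Complex.log_mul hp0 (inv_ne_zero hq0)
  rw [arg_inv, if_neg hqpi]
  have p1 := arg_le_pi p
  have p2 := neg_pi_lt_arg p
  have q1 := arg_le_pi q
  have q2 := neg_pi_lt_arg q
  have q1' := lt_of_le_of_ne q1 hqpi
  have p1' := lt_of_le_of_ne p1 hppi
  have him : (p * q⁻¹).im = ‖p‖ * ‖q‖⁻¹ * Real.sin (arg p - arg q) := by
    have e1 : p * q⁻¹ = ((‖p‖ * ‖q‖⁻¹ : ℝ) : ℂ) * exp (((arg p - arg q : ℝ) : ℂ) * I) := by
      conv_lhs => rw [← norm_mul_exp_arg_mul_I p, ← norm_mul_exp_arg_mul_I q]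
      rw [mul_inv, ← Complex.exp_neg]
      push_cast
      rw [sub_mul, sub_eq_add_neg, Complex.exp_add]
      ring
    rw [e1, im_ofReal_mul, exp_ofReal_mul_I_im]
  have hpos : 0 < ‖p‖ * ‖q‖⁻¹ := by
    have := norm_pos_iff.2 hp0
    have := norm_pos_iff.2 hq0
    positivity
  rcases lt_trichotomy q.im 0 with h | h | h
  · have h3 := h2 h
    have q3 : arg q < 0 := arg_neg_iff.2 h
    rw [him] at h3
    have h4 : 0 < Real.sin (arg p - arg q) := by
      by_contra hcon
      push Not at hcon
      nlinarith
    refine ⟨by linarith, ?_⟩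
    by_contra hcon
    push Not at hcon
    have : 0 ≤ Real.sin (arg p - arg q - Real.pi) :=
      Real.sin_nonneg_of_nonneg_of_le_pi (by linarith) (by linarith)
    rw [Real.sin_sub_pi] at this
    linarith
  · have : arg q = 0 := arg_eq_zero_iff.2 ⟨(h0 h).le, h⟩
    rw [this]
    constructor <;> linarith
  · have h3 := h1 h
    have q3 : 0 ≤ arg q := arg_nonneg_iff.2 h.le
    rw [him] at h3
    have h4 : Real.sin (arg p - arg q) < 0 := by
      by_contra hcon
      push Not at hcon
      nlinarith [mul_nonneg hpos.le hcon]
    refine ⟨?_, by linarith⟩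
    by_contra hcon
    push Not at hcon
    have : 0 ≤ Real.sin (arg p - arg q + 2 * Real.pi) :=
      Real.sin_nonneg_of_nonneg_of_le_pi (by linarith) (by linarith)
    rw [Real.sin_add_two_pi] at this
    linarith

lemma aux_branch (q : ℂ) (hq : ‖q‖ < 1) (hqs : q.im = 0 → 0 < q.re) (θ : ℝ) :
    Complex.log (q⁻¹ + q + 2 * (Real.cos θ : ℂ)) = Complex.log q⁻¹ +
      (Complex.log (1 + q * exp (θ * I)) + Complex.log (1 + q * exp (-(θ * I)))) := by
  have hqsl : q ∈ slitPlane := by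
    by_cases h : q.im = 0
    · exact Or.inl (hqs h)
    · exact Or.inr h
  have hq0 := slitPlane_ne_zero hqsl
  set A := 1 + q * exp (θ * I) with hA
  set B := 1 + q * exp (-(θ * I)) with hB
  have hAr : 0 < A.re := aux_slit hq (by rw [norm_exp_ofReal_mul_I])
  have hBr : 0 < B.re := aux_slit hq (by
    rw [show -((θ : ℂ) * I) = ((-θ : ℝ) : ℂ) * I by push_cast; ring, norm_exp_ofReal_mul_I])
  have hA0 : A ≠ 0 := by intro h; simp [h] at hAr
  have hB0 : B ≠ 0 := by intro h; simp [h] at hBr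
  have hAa := abs_lt.1 (abs_arg_lt_pi_div_two_iff.2 (Or.inl hAr))
  have hBa := abs_lt.1 (abs_arg_lt_pi_div_two_iff.2 (Or.inl hBr))
  have hmem : arg A + arg B ∈ Set.Ioc (-Real.pi) Real.pi := by
    constructor <;> linarith [hAa.1, hAa.2, hBa.1, hBa.2]
  have hlogAB := Complex.log_mul hA0 hB0 hmem
  have hargAB := Complex.arg_mul hA0 hB0 hmem
  have hABs : A * B ∈ slitPlane := by
    rw [mem_slitPlane_iff_arg]
    refine ⟨?_, mul_ne_zero hA0 hB0⟩
    rw [hargAB]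
    intro h
    linarith [hAa.2, hBa.2]
  have hprod : q⁻¹ + q + 2 * (Real.cos θ : ℂ) = (A * B) * q⁻¹ := by
    have hne : exp (θ * I) ≠ 0 := exp_ne_zero _
    have hcos : (Real.cos θ : ℂ) = (exp (θ * I) + (exp (θ * I))⁻¹) / 2 := by
      rw [ofReal_cos, Complex.cos, ← Complex.exp_neg, neg_mul]
    rw [hcos, hA, hB, Complex.exp_neg]
    field_simp
    ring
  have him : ((A * B) * q⁻¹).im = q.im * (1 - (normSq q)⁻¹) := by
    rw [← hprod]
    simp only [add_im, inv_im, mul_im, ofReal_im, ofReal_re, re_ofNat, im_ofNat]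
    ring
  have hn : 1 < (normSq q)⁻¹ := by
    have h1 : 0 < normSq q := normSq_pos.2 hq0
    rw [one_lt_inv₀ h1, normSq_eq_norm_sq]
    have := norm_nonneg q
    nlinarith
  rw [hprod, ← hlogAB, aux_log_div (A * B) q hABs hqsl hqs, add_comm]
  · intro h; rw [him]; nlinarith
  · intro h; rw [him]; nlinarith

/-- Closed form for `g(ζ) = (2/(πa)) ∫_0^a ln(ζ - s) √((a-s)/s) ds` on `ℂ \ (-∞, a]`:
`g(ζ) = -(2/a)√(ζ(ζ-a)) - ln a + ln(2ζ - a + 2√(ζ(ζ-a))) + 2ζ/a + ln(a/(4e))`. -/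
theorem g_closed_form (a : ℝ) (ha : 0 < a) (ζ : ℂ) (hζ : ζ.im ≠ 0 ∨ a < ζ.re) :
    ((2 / (Real.pi * a) : ℝ) : ℂ) *
        ∫ s in (0 : ℝ)..a, Complex.log (ζ - (s : ℂ)) * (Real.sqrt ((a - s) / s) : ℂ)
      = -(2 / (a : ℂ)) * sqrtBranch a ζ - (Real.log a : ℂ)
          + Complex.log (2 * ζ - (a : ℂ) + 2 * sqrtBranch a ζ)
          + 2 * ζ / (a : ℂ) + (Real.log (a / (4 * Real.exp 1)) : ℂ) := by
  have haC : (a : ℂ) ≠ 0 := by exact_mod_cast ha.ne'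
  have hζ0 : ζ ≠ 0 := by
    rintro rfl
    rcases hζ with h | h
    · simp at h
    · simp at h; linarith
  have hsl : 1 - (a : ℂ) / ζ ∈ slitPlane := by
    have hn : 0 < normSq ζ := normSq_pos.2 hζ0
    by_cases him : ζ.im = 0
    · have hre : a < ζ.re := hζ.resolve_left (by simpa using him)
      left
      have hz : ζ = (ζ.re : ℂ) := by apply Complex.ext <;> simp [him]
      rw [hz, ← ofReal_div, sub_re, one_re, ofReal_re]
      have : a / ζ.re < 1 := by rw [div_lt_one (by linarith)]; exact hre
      linarith
    · right
      have : (1 - (a : ℂ) / ζ).im = a * ζ.im / normSq ζ := by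
        simp [div_im]
      rw [this]
      have := ha.ne'
      positivity
  set r : ℂ := (1 - (a : ℂ) / ζ) ^ ((1 : ℂ) / 2) with hr
  have hb0 := slitPlane_ne_zero hsl
  have hr2 : r ^ 2 = 1 - (a : ℂ) / ζ := by
    rw [hr, one_div]
    exact_mod_cast Complex.cpow_nat_inv_pow (1 - (a : ℂ) / ζ) two_ne_zero
  have hrre : 0 < r.re := by
    rw [hr, cpow_def_of_ne_zero hb0, exp_re]
    apply mul_pos (Real.exp_pos _)
    have e : (Complex.log (1 - (a : ℂ) / ζ) * (1 / 2)).im = arg (1 - (a : ℂ) / ζ) / 2 := by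
      rw [show (1 / 2 : ℂ) = ((1 / 2 : ℝ) : ℂ) by push_cast; rfl, im_mul_ofReal, log_im]
      ring
    rw [e]
    have h1 := arg_le_pi (1 - (a : ℂ) / ζ)
    have h2 := neg_pi_lt_arg (1 - (a : ℂ) / ζ)
    have h3 := lt_of_le_of_ne h1 (slitPlane_arg_ne_pi hsl)
    apply Real.cos_pos_of_mem_Ioo
    constructor <;> linarith
  have hS : sqrtBranch a ζ = ζ * r := rfl
  rw [hS]
  have haζ : (a : ℂ) = ζ * (1 - r ^ 2) := by rw [hr2]; field_simp; ring
  have h1r : 1 + r ≠ 0 := by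
    intro h
    have := congrArg Complex.re h
    simp at this
    linarith
  have h1r' : 1 - r ≠ 0 := by
    intro h
    apply haC
    rw [haζ, show 1 - r ^ 2 = (1 - r) * (1 + r) by ring, h]; ring
  set q : ℂ := (1 - r) / (1 + r) with hqdef
  have hq0 : q ≠ 0 := div_ne_zero h1r' h1r
  have hq : ‖q‖ < 1 := by
    rw [hqdef, norm_div, div_lt_one (norm_pos_iff.2 h1r), ← sq_lt_sq₀ (norm_nonneg _) (norm_nonneg _),
      ← normSq_eq_norm_sq, ← normSq_eq_norm_sq, normSq_apply, normSq_apply]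
    simp
    nlinarith
  have hw : 2 * ζ - (a : ℂ) + 2 * (ζ * r) = (a : ℂ) * q⁻¹ := by
    rw [hqdef, haζ]
    field_simp
    ring
  have hqval : q = 2 * ζ / a - 1 - 2 / a * (ζ * r) := by
    have : (a : ℂ) * q = 2 * ζ - a - 2 * (ζ * r) := by
      rw [hqdef, haζ]
      field_simp
      ring
    field_simp
    linear_combination this
  have hζq : ζ = ((a / 4 : ℝ) : ℂ) * (q⁻¹ + q + 2) := by
    push_cast
    have e1 : (a : ℂ) * q⁻¹ = 2 * ζ - (a : ℂ) + 2 * (ζ * r) := hw.symm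
    have e2 : (a : ℂ) * q = 2 * ζ - a - 2 * (ζ * r) := by
      rw [hqval]; field_simp
    linear_combination -(1 / 4) * e1 - (1 / 4) * e2
  have hqs : q.im = 0 → 0 < q.re := by
    intro him
    have hz : q = (q.re : ℂ) := by apply Complex.ext <;> simp [him]
    by_contra hcon
    push Not at hcon
    rw [hz, ← ofReal_inv] at hζq
    have hζq' : ζ = ((a / 4 * (q.re⁻¹ + q.re + 2) : ℝ) : ℂ) := by
      rw [hζq]; push_cast; ring
    rcases hζ with h | h
    · rw [hζq'] at h; simp only [ofReal_im, ne_eq, not_true_eq_false] at h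
    · rw [hζq', ofReal_re] at h
      have : q.re⁻¹ ≤ 0 := inv_nonpos.2 hcon
      nlinarith
  have hlog : ∀ θ : ℝ, Complex.log (ζ - ((a * (1 - Real.cos θ) / 2 : ℝ) : ℂ)) =
      ((Real.log (a / 4) : ℝ) : ℂ) + Complex.log q⁻¹ +
      (Complex.log (1 + q * exp (θ * I)) + Complex.log (1 + q * exp (-(θ * I)))) := by
    intro θ
    have e : ζ - ((a * (1 - Real.cos θ) / 2 : ℝ) : ℂ) =
        ((a / 4 : ℝ) : ℂ) * (q⁻¹ + q + 2 * (Real.cos θ : ℂ)) := by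
      rw [hζq]; push_cast; ring
    have hne : q⁻¹ + q + 2 * (Real.cos θ : ℂ) ≠ 0 := by
      intro h
      rw [h, mul_zero, sub_eq_zero] at e
      rcases hζ with h | h
      · rw [e, ofReal_im] at h; exact h rfl
      · rw [e, ofReal_re] at h
        nlinarith [Real.neg_one_le_cos θ]
    rw [e, log_ofReal_mul (by positivity) hne, aux_branch q hq hqs θ]
    ring
  rw [aux_subst a ha (fun s => Complex.log (ζ - (s : ℂ)))]
  simp only [hlog]
  set C : ℂ := ((Real.log (a / 4) : ℝ) : ℂ) + Complex.log q⁻¹ with hC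
  rw [intervalIntegral.integral_const_mul]
  have hint : ∫ θ in (0 : ℝ)..Real.pi, (C +
      (Complex.log (1 + q * exp (θ * I)) + Complex.log (1 + q * exp (-(θ * I))))) *
      (1 + (Real.cos θ : ℂ)) = Real.pi * C + Real.pi * q := by
    simp only [add_mul C]
    have hcA := aux_cont q hq
    have hcB : Continuous (fun θ : ℝ =>
        (Complex.log (1 + q * exp (θ * I)) + Complex.log (1 + q * exp (-(θ * I))))
        * (1 + (Real.cos θ : ℂ))) := by
      have h2 := hcA.comp continuous_neg
      refine (hcA.add h2).congr ?_
      intro θ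
      simp only [Pi.add_apply, Function.comp_apply, Real.cos_neg, ofReal_neg, neg_mul, add_mul]
    rw [intervalIntegral.integral_add ((by fun_prop : Continuous _).intervalIntegrable _ _)
      (hcB.intervalIntegrable _ _), aux_half q hq, intervalIntegral.integral_const_mul,
      intervalIntegral.integral_add ((by fun_prop : Continuous _).intervalIntegrable _ _)
      ((by fun_prop : Continuous _).intervalIntegrable _ _), intervalIntegral.integral_ofReal,
      integral_cos]
    simp
    ring
  rw [hint, hw, log_ofReal_mul ha (inv_ne_zero hq0), hC]
  have hl1 : Real.log (a / (4 * Real.exp 1)) = Real.log (a / 4) - 1 := by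
    rw [← div_div, Real.log_div (by positivity) (Real.exp_pos 1).ne', Real.log_exp]
  have hpi : (Real.pi : ℂ) ≠ 0 := by exact_mod_cast Real.pi_ne_zero
  rw [hl1]
  push_cast
  have : (2 / ((Real.pi : ℂ) * a)) * (a / 2 * (Real.pi * ((Real.log (a / 4) : ℂ) + Complex.log q⁻¹)
      + Real.pi * q)) = (Real.log (a / 4) : ℂ) + Complex.log q⁻¹ + q := by
    field_simp
  rw [this]
  linear_combination hqval
end

section
/- The function g(ζ) = −(2/a)√(ζ(ζ−a)) − ln a + ln(2ζ − a + 2√(ζ(ζ−a))) + 2ζ/a + ln(a/(4e)) admits, as ζ → ∞, the asymptotic expansion g(ζ) = ln ζ − Σ_{j≥1} (2(2j−1)!/((j+1)(j!)²)) · a^j/(4^j ζ^j); in particular g(ζ) = ln ζ − a/(4ζ) − a²/(16ζ²) − 5a³/(192ζ³) + O(ζ^{−4}). -/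
open Complex Filter Asymptotics
open scoped Nat

/-- The function `g(ζ)` in closed form. -/
noncomputable def gFun (a : ℝ) (ζ : ℂ) : ℂ :=
  -(2 / (a : ℂ)) * sqrtBranch a ζ - (Real.log a : ℂ)
    + Complex.log (2 * ζ - (a : ℂ) + 2 * sqrtBranch a ζ)
    + 2 * ζ / (a : ℂ) + (Real.log (a / (4 * Real.exp 1)) : ℂ)

/-- Truncated Catalan generating polynomial. -/
noncomputable def catP (N : ℕ) : Polynomial ℂ :=
  ∑ n ∈ Finset.range N, Polynomial.monomial n (catalan n : ℂ)

/-- Shifted truncated Catalan generating polynomial. -/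
noncomputable def catQ (N : ℕ) : Polynomial ℂ :=
  ∑ n ∈ Finset.range N, Polynomial.monomial n (catalan (n + 1) : ℂ)

lemma catP_coeff (N k : ℕ) : (catP N).coeff k = if k < N then (catalan k : ℂ) else 0 := by
  simp [catP, Polynomial.coeff_monomial]

lemma catQ_coeff (N k : ℕ) :
    (catQ N).coeff k = if k < N then (catalan (k + 1) : ℂ) else 0 := by
  simp [catQ, Polynomial.coeff_monomial]

lemma catP_succ_eval (N : ℕ) (x : ℂ) :
    (catP (N + 1)).eval x = 1 + x * (catQ N).eval x := by
  simp only [catP, catQ, Polynomial.eval_finsetSum, Polynomial.eval_monomial]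
  rw [Finset.sum_range_succ', Finset.mul_sum]
  simp only [catalan_zero, pow_zero]
  rw [add_comm]
  congr 1
  · simp
  · refine Finset.sum_congr rfl fun i _ => ?_
    ring

lemma catPQ_dvd (N : ℕ) : (Polynomial.X : Polynomial ℂ) ^ N ∣ catP N ^ 2 - catQ N := by
  rw [Polynomial.X_pow_dvd_iff]
  intro d hd
  rw [Polynomial.coeff_sub, sq, Polynomial.coeff_mul, catQ_coeff, if_pos hd, catalan_succ']
  push_cast
  rw [sub_eq_zero]
  refine Finset.sum_congr rfl fun p hp => ?_
  have := Finset.HasAntidiagonal.mem_antidiagonal.mp hp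
  rw [catP_coeff, catP_coeff, if_pos (by omega), if_pos (by omega)]

lemma poly_isBigO_one (p : Polynomial ℂ) :
    (fun x : ℂ => p.eval x) =O[nhds 0] (fun _ => (1 : ℂ)) :=
  (p.continuous.tendsto 0).isBigO_one ℂ

lemma sq_step (y : ℂ → ℂ) (hb : y =O[nhds 0] (fun _ => (1 : ℂ))) (N : ℕ)
    (h : (fun x => y x - (catP N).eval x) =O[nhds 0] fun x : ℂ => x ^ N) :
    (fun x => y x ^ 2 - (catQ N).eval x) =O[nhds 0] fun x : ℂ => x ^ N := by
  obtain ⟨K, hK⟩ := catPQ_dvd N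
  have h1 := h.mul (hb.add (poly_isBigO_one (catP N)))
  have h2 := (Asymptotics.isBigO_refl (fun x : ℂ => x ^ N) (nhds 0)).mul (poly_isBigO_one K)
  have h3 := h1.add h2
  refine (h3.congr_left fun x => ?_).congr_right fun x => by simp
  have := congrArg (Polynomial.eval x) hK
  simp only [Polynomial.eval_sub, Polynomial.eval_pow, Polynomial.eval_mul,
    Polynomial.eval_X] at this
  rw [← this]
  ring

lemma cat_expand (y : ℂ → ℂ) (hb : y =O[nhds 0] (fun _ => (1 : ℂ)))
    (hy : ∀ᶠ x in nhds 0, y x = 1 + x * y x ^ 2) (N : ℕ) :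
    (fun x => y x - (catP N).eval x) =O[nhds 0] fun x : ℂ => x ^ N := by
  induction N with
  | zero => simpa [catP] using hb
  | succ N ih =>
    have h := (Asymptotics.isBigO_refl (fun x : ℂ => x) (nhds 0)).mul (sq_step y hb N ih)
    refine (h.congr' ?_ ?_)
    · filter_upwards [hy] with x hx
      rw [catP_succ_eval]
      linear_combination -hx
    · exact Eventually.of_forall fun x => by ring

/-- The square root factor. -/
noncomputable def sF (x : ℂ) : ℂ := (1 - 4 * x) ^ ((1 : ℂ) / 2)

/-- The normalised function. -/
noncomputable def FF (x : ℂ) : ℂ := 2 / (1 + sF x) - 1 + Complex.log (((1 + sF x) / 2) ^ 2)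

lemma sF_sq (x : ℂ) : sF x ^ 2 = 1 - 4 * x := by
  have := Complex.cpow_nat_inv_pow (1 - 4 * x) (n := 2) (by norm_num)
  simpa [sF] using this

lemma sF_zero : sF 0 = 1 := by simp [sF]

lemma sF_cont : ContinuousAt sF 0 := by
  unfold sF
  refine ContinuousAt.cpow (by fun_prop) continuousAt_const ?_
  simp

lemma sF_re : ∀ᶠ x in nhds (0 : ℂ), 0 < (sF x).re := by
  have : ContinuousAt (fun x => (sF x).re) 0 := Complex.continuous_re.continuousAt.comp sF_cont
  exact this.eventually (lt_mem_nhds (by simp [sF_zero]))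

lemma slit1 : ∀ᶠ x in nhds (0 : ℂ), 1 - 4 * x ∈ Complex.slitPlane := by
  have : ContinuousAt (fun x : ℂ => 1 - 4 * x) 0 := by fun_prop
  exact this.eventually (Complex.isOpen_slitPlane.mem_nhds (by simp))

lemma slit2 : ∀ᶠ x in nhds (0 : ℂ), ((1 + sF x) / 2) ^ 2 ∈ Complex.slitPlane := by
  have : ContinuousAt (fun x : ℂ => ((1 + sF x) / 2) ^ 2) 0 := by
    have := sF_cont
    fun_prop
  refine this.eventually (Complex.isOpen_slitPlane.mem_nhds ?_)
  simp only [sF_zero]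
  norm_num

lemma ne_of_re {s : ℂ} (h : 0 < s.re) : s ≠ 0 ∧ 1 + s ≠ 0 := by
  constructor
  · rintro rfl; simp at h
  · intro h0
    have := congrArg Complex.re h0
    simp at this
    linarith

lemma FF_deriv : ∀ᶠ x in nhds (0 : ℂ), HasDerivAt FF (-(2 / (1 + sF x)) ^ 2) x := by
  filter_upwards [sF_re, slit1, slit2] with x h1 h2 h3
  obtain ⟨hs, hs1⟩ := ne_of_re h1
  have hd : HasDerivAt sF (-2 / sF x) x := by
    have h := (((hasDerivAt_id x).const_mul (4 : ℂ)).const_sub 1).cpow_const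
      (c := (1 : ℂ) / 2) h2
    refine h.congr_deriv ?_
    have e : (1 - 4 * x) ^ ((1 : ℂ) / 2 - 1) = 1 / sF x := by
      rw [Complex.cpow_sub _ _ (Complex.slitPlane_ne_zero h2), Complex.cpow_one]
      have e2 := sF_sq x
      change sF x / _ = _
      rw [← e2]
      field_simp
    simp only [id, e]
    ring
  have hw := ((hd.const_add 1).div_const 2).pow 2
  have hl := hw.clog h3
  have hi := ((hasDerivAt_const x (2 : ℂ)).div (hd.const_add 1) hs1).sub_const 1
  refine (hi.add hl).congr_deriv ?_
  simp
  field_simp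
  ring

lemma FF_zero : FF 0 = 0 := by
  simp [FF, sF_zero]; norm_num

lemma yb : (fun x => 2 / (1 + sF x)) =O[nhds 0] (fun _ => (1 : ℂ)) := by
  have : ContinuousAt (fun x => 2 / (1 + sF x)) 0 := by
    refine ContinuousAt.div continuousAt_const (continuousAt_const.add sF_cont) ?_
    rw [sF_zero]; norm_num
  exact this.tendsto.isBigO_one ℂ

lemma yeq : ∀ᶠ x in nhds (0 : ℂ),
    (fun x => 2 / (1 + sF x)) x = 1 + x * (fun x => 2 / (1 + sF x)) x ^ 2 := by
  filter_upwards [sF_re] with x h1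
  obtain ⟨hs, hs1⟩ := ne_of_re h1
  have := sF_sq x
  field_simp
  linear_combination -this

lemma int_step (H H' : ℂ → ℂ) (h0 : H 0 = 0) (N : ℕ)
    (hd : ∀ᶠ x in nhds (0 : ℂ), HasDerivAt H (H' x) x)
    (hO : H' =O[nhds 0] fun x : ℂ => x ^ N) :
    H =O[nhds 0] fun x : ℂ => x ^ (N + 1) := by
  obtain ⟨C, hC⟩ := hO.bound
  obtain ⟨r, hr, hball⟩ := Metric.eventually_nhds_iff.mp (hd.and hC)
  refine Asymptotics.IsBigO.of_bound |C| ?_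
  filter_upwards [Metric.ball_mem_nhds (0 : ℂ) hr] with x hx
  have hx' : ‖x‖ < r := by simpa using hx
  have hsub : ∀ z ∈ Metric.closedBall (0 : ℂ) ‖x‖, dist z 0 < r := fun z hz =>
    lt_of_le_of_lt (Metric.mem_closedBall.mp hz) hx'
  have hC0 : ∀ z ∈ Metric.closedBall (0 : ℂ) ‖x‖, ‖H' z‖ ≤ |C| * ‖x‖ ^ N := by
    intro z hz
    have hz' : ‖z‖ ≤ ‖x‖ := by simpa using hz
    refine ((hball (hsub z hz)).2).trans ?_
    rw [norm_pow]
    gcongr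
    exact le_abs_self C
  have := (convex_closedBall (0 : ℂ) ‖x‖).norm_image_sub_le_of_norm_hasDerivWithin_le
    (fun z hz => (hball (hsub z hz)).1.hasDerivWithinAt) hC0
    (Metric.mem_closedBall_self (norm_nonneg x)) (y := x) (by simp)
  rw [h0, sub_zero, sub_zero] at this
  rw [norm_pow, pow_succ, ← mul_assoc]
  exact this

lemma FF_expand (M : ℕ) :
    (fun x : ℂ => FF x + ∑ n ∈ Finset.range M, (catalan (n + 1) : ℂ) / (n + 1) * x ^ (n + 1))
      =O[nhds 0] fun x : ℂ => x ^ (M + 1) := by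
  have h := sq_step _ yb M (cat_expand _ yb yeq M)
  refine int_step _ (fun x => -(2 / (1 + sF x)) ^ 2 + (catQ M).eval x) (by simp [FF_zero]) M ?_ ?_
  · filter_upwards [FF_deriv] with x hx
    refine hx.add ?_
    have : HasDerivAt (fun x : ℂ => ∑ n ∈ Finset.range M,
        (catalan (n + 1) : ℂ) / (n + 1) * x ^ (n + 1))
        (∑ n ∈ Finset.range M, (catalan (n + 1) : ℂ) / (n + 1) * ((n + 1 : ℕ) * x ^ n)) x := by
      refine HasDerivAt.fun_sum fun n _ => ?_
      simpa using (hasDerivAt_pow (n + 1) x).const_mul ((catalan (n + 1) : ℂ) / (n + 1))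
    refine this.congr_deriv ?_
    simp only [catQ, Polynomial.eval_finsetSum, Polynomial.eval_monomial]
    refine Finset.sum_congr rfl fun n _ => ?_
    have : (n + 1 : ℂ) ≠ 0 := by exact_mod_cast Nat.succ_ne_zero n
    push_cast
    field_simp
  · exact h.neg_left.congr_left fun x => by ring

lemma arg_aux {z w : ℂ} (hz : 0 < z.im) (hw : 0 < w.im) (hzw : 0 < (z * w).im) :
    z.arg + w.arg ≤ Real.pi := by
  by_contra! hlt
  have h1 : z.arg ≤ Real.pi := Complex.arg_le_pi z
  have h2 : w.arg < Real.pi := by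
    refine lt_of_le_of_ne (Complex.arg_le_pi w) fun h => ?_
    exact hw.ne' (Complex.arg_eq_pi_iff.mp h).2
  have hs : Real.sin (z.arg + w.arg) < 0 := by
    have := Real.sin_pos_of_pos_of_lt_pi (x := z.arg + w.arg - Real.pi) (by linarith) (by linarith)
    rw [Real.sin_sub_pi] at this
    linarith
  have e : (z * w).im = ‖z‖ * ‖w‖ * Real.sin (z.arg + w.arg) := by
    rw [Real.sin_add]
    have a1 := Complex.norm_mul_cos_arg z
    have a2 := Complex.norm_mul_sin_arg z
    have a3 := Complex.norm_mul_cos_arg w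
    have a4 := Complex.norm_mul_sin_arg w
    rw [Complex.mul_im, ← a1, ← a2, ← a3, ← a4]
    ring
  have : 0 ≤ ‖z‖ * ‖w‖ := by positivity
  nlinarith

lemma log_aux_pos {z w : ℂ} (hz : 0 < z.im) (hw : 0 < w.im) (hzw : 0 < (z * w).im) :
    Complex.log (z * w) = Complex.log z + Complex.log w := by
  refine Complex.log_mul (by rintro rfl; simp at hz) (by rintro rfl; simp at hw) ⟨?_, arg_aux hz hw hzw⟩
  have h1 := Complex.arg_nonneg_iff.mpr hz.le
  have h2 := Complex.arg_nonneg_iff.mpr hw.le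
  linarith [Real.pi_pos]

lemma log_aux_neg {z w : ℂ} (hz : z.im < 0) (hw : w.im < 0) (hzw : (z * w).im < 0) :
    Complex.log (z * w) = Complex.log z + Complex.log w := by
  have h := log_aux_pos (z := (starRingEnd ℂ) z) (w := (starRingEnd ℂ) w) (by simpa using hz)
    (by simpa using hw) (by rw [← map_mul]; rw [Complex.conj_im]; linarith)
  have key : ∀ u : ℂ, u.im < 0 → Complex.log ((starRingEnd ℂ) u) = (starRingEnd ℂ) (Complex.log u) := by
    intro u hu
    exact Complex.log_conj _ fun h => hu.ne (Complex.arg_eq_pi_iff.mp h).2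
  rw [← map_mul, key _ hzw, key _ hz, key _ hw, ← map_add] at h
  exact (starRingEnd ℂ).injective h

lemma log_split (a : ℝ) (ha : 0 < a) (ζ s : ℂ) (hζ : ζ.im ≠ 0 ∨ a < ζ.re) (hs : 0 < s.re)
    (h : s ^ 2 = 1 - a / ζ) :
    Complex.log (ζ * ((1 + s) / 2) ^ 2) = Complex.log ζ + Complex.log (((1 + s) / 2) ^ 2) := by
  have hζ0 : ζ ≠ 0 := by
    rintro rfl
    simp at hζ
    linarith
  have hn : 0 < Complex.normSq ζ := Complex.normSq_pos.mpr hζ0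
  have him : 2 * s.re * s.im * Complex.normSq ζ = a * ζ.im := by
    have := congrArg Complex.im h
    simp [sq, Complex.div_im] at this
    field_simp at this
    linarith
  have hwim : ((((1 + s) / 2) ^ 2).im) = (1 + s.re) * s.im / 2 := by
    have : ((1 + s) / 2) ^ 2 = ((1 / 4 : ℝ) : ℂ) * ((1 + s) * (1 + s)) := by push_cast; ring
    rw [this, Complex.im_ofReal_mul]
    simp
    ring
  have hprod : ∃ c : ℝ, 0 < c ∧ (ζ * ((1 + s) / 2) ^ 2).im = c * s.im := by
    have haC : (a : ℂ) ≠ 0 := by exact_mod_cast ha.ne'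
    have h1s : 1 - s ≠ 0 := by
      intro h0
      have : s = 1 := by linear_combination -h0
      rw [this] at h
      have : (a : ℂ) / ζ = 0 := by linear_combination h
      simp [haC, hζ0] at this
    have hm : 0 < Complex.normSq (1 - s) := Complex.normSq_pos.mpr h1s
    refine ⟨a / (2 * Complex.normSq (1 - s)), by positivity, ?_⟩
    have e : ζ * ((1 + s) / 2) ^ 2 = ((a / 4 : ℝ) : ℂ) * ((1 + s) / (1 - s)) := by
      have : ζ * s ^ 2 = ζ - a := by rw [h]; field_simp
      push_cast
      field_simp
      linear_combination (-4 * (1 + s)) * this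
    rw [e, Complex.im_ofReal_mul, Complex.div_im]
    simp
    field_simp
    ring
  obtain ⟨c, hc, hce⟩ := hprod
  rcases lt_trichotomy ζ.im 0 with hi | hi | hi
  · have hsi : s.im < 0 := by
      by_contra! h0
      have : 0 ≤ 2 * s.re * s.im * Complex.normSq ζ := by positivity
      nlinarith
    refine log_aux_neg hi ?_ ?_
    · rw [hwim]; nlinarith
    · rw [hce]; nlinarith
  · have hre : 0 < ζ.re := by
      rcases hζ with h' | h'
      · exact absurd hi h'
      · linarith
    have : ζ = (ζ.re : ℂ) := Complex.ext (by simp) (by simp [hi])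
    rw [this, Complex.log_ofReal_mul hre, Complex.ofReal_log hre.le]
    exact pow_ne_zero _ (div_ne_zero (ne_of_re hs).2 two_ne_zero)
  · have hsi : 0 < s.im := by
      by_contra! h0
      have : 0 < a * ζ.im := by positivity
      have h3 : 0 < 2 * s.re * Complex.normSq ζ := by positivity
      nlinarith
    refine log_aux_pos hi ?_ ?_
    · rw [hwim]; positivity
    · rw [hce]; positivity

lemma g_eq (a : ℝ) (ha : 0 < a) (ζ : ℂ) (hζ : ζ.im ≠ 0 ∨ a < ζ.re)
    (hs : 0 < (sF (a / 4 * ζ⁻¹)).re) :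
    gFun a ζ - Complex.log ζ = FF (a / 4 * ζ⁻¹) := by
  have haC : (a : ℂ) ≠ 0 := by exact_mod_cast ha.ne'
  have hζ0 : ζ ≠ 0 := by
    rintro rfl
    simp at hζ
    linarith
  have hx : 1 - 4 * (a / 4 * ζ⁻¹) = 1 - a / ζ := by ring
  have hsq := sF_sq (a / 4 * ζ⁻¹)
  have hsb : sqrtBranch a ζ = ζ * sF (a / 4 * ζ⁻¹) := by
    rw [sqrtBranch, sF, hx]
  rw [hx] at hsq
  unfold gFun FF
  rw [hsb]
  generalize sF (a / 4 * ζ⁻¹) = s at *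
  have h1s := (ne_of_re hs).2
  have hl := log_split a ha ζ s hζ hs hsq
  have hm : ζ * s ^ 2 = ζ - a := by rw [hsq]; field_simp
  have e1 : 2 * ζ - a + 2 * (ζ * s) = ((4 : ℝ) : ℂ) * (ζ * ((1 + s) / 2) ^ 2) := by
    push_cast
    linear_combination -hm
  have hne : ζ * ((1 + s) / 2) ^ 2 ≠ 0 :=
    mul_ne_zero hζ0 (pow_ne_zero _ (div_ne_zero h1s two_ne_zero))
  rw [e1, Complex.log_ofReal_mul (by norm_num) hne, hl,
    Real.log_div ha.ne' (by positivity), Real.log_mul (by norm_num) (Real.exp_pos 1).ne',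
    Real.log_exp]
  have e2 : -(2 / (a : ℂ)) * (ζ * s) + 2 * ζ / a = 2 / (1 + s) := by
    field_simp
    linear_combination -hm
  push_cast
  linear_combination e2

lemma cat_coef (n : ℕ) : (catalan (n + 1) : ℝ) / (n + 1)
    = 2 * (2 * (n + 1) - 1)! / (((n + 1 : ℕ) + 1) * ((n + 1) !) ^ 2) := by
  have h := succ_mul_catalan_eq_centralBinom (n + 1)
  have h2 := Nat.centralBinom_eq_two_mul_choose (n + 1)
  have h3 := Nat.choose_mul_factorial_mul_factorial (n := 2 * (n + 1)) (k := n + 1) (by omega)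
  have hf : (2 * (n + 1))! = 2 * (n + 1) * (2 * (n + 1) - 1)! :=
    (Nat.mul_factorial_pred (by omega)).symm
  rw [← h2, ← h, show 2 * (n + 1) - (n + 1) = n + 1 by omega, hf] at h3
  have h5 := congrArg (Nat.cast : ℕ → ℝ) h3
  push_cast at h5 ⊢
  have : (n + 1 : ℝ) ≠ 0 := by positivity
  rw [div_eq_div_iff (by positivity) (by positivity)]
  linear_combination h5

lemma main_exp (a : ℝ) (ha : 0 < a) (M : ℕ) :
      (fun ζ : ℂ => gFun a ζ - Complex.log ζ
          + ∑ j ∈ Finset.Icc 1 M,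
              ((2 * (2 * j - 1)! / ((j + 1) * (j !) ^ 2) : ℝ) : ℂ) * (a : ℂ) ^ j
                / (4 ^ j * ζ ^ j))
        =O[Bornology.cobounded ℂ ⊓ Filter.principal {ζ : ℂ | ζ.im ≠ 0 ∨ a < ζ.re}]
          fun ζ : ℂ => ζ ^ (-(M : ℤ) - 1) := by
  have ht : Tendsto (fun ζ : ℂ => (a : ℂ) / 4 * ζ⁻¹) (Bornology.cobounded ℂ) (nhds 0) := by
    simpa using (tendsto_inv₀_cobounded (α := ℂ)).const_mul ((a : ℂ) / 4)
  have h := ((FF_expand M).comp_tendsto ht).mono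
    (inf_le_left (b := Filter.principal {ζ : ℂ | ζ.im ≠ 0 ∨ a < ζ.re}))
  have h2 : ((fun x : ℂ => x ^ (M + 1)) ∘ fun ζ : ℂ => (a : ℂ) / 4 * ζ⁻¹)
      =O[Bornology.cobounded ℂ ⊓ Filter.principal {ζ : ℂ | ζ.im ≠ 0 ∨ a < ζ.re}]
      fun ζ : ℂ => ζ ^ (-(M : ℤ) - 1) := by
    refine Asymptotics.IsBigO.of_bound ‖((a : ℂ) / 4) ^ (M + 1)‖ (Eventually.of_forall fun ζ => ?_)
    have : ζ ^ (-(M : ℤ) - 1) = (ζ⁻¹) ^ (M + 1) := by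
      rw [show -(M : ℤ) - 1 = -((M + 1 : ℕ) : ℤ) by push_cast; ring, zpow_neg, zpow_natCast, inv_pow]
    simp only [Function.comp, this, mul_pow, norm_mul]
    exact le_rfl
  refine (h.trans h2).congr' ?_ EventuallyEq.rfl
  have e1 : ∀ᶠ ζ in Bornology.cobounded ℂ ⊓ Filter.principal {ζ : ℂ | ζ.im ≠ 0 ∨ a < ζ.re},
      0 < (sF (a / 4 * ζ⁻¹)).re := (ht.eventually sF_re).filter_mono inf_le_left
  have e2 : ∀ᶠ ζ in Bornology.cobounded ℂ ⊓ Filter.principal {ζ : ℂ | ζ.im ≠ 0 ∨ a < ζ.re},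
      ζ.im ≠ 0 ∨ a < ζ.re := mem_inf_of_right (mem_principal_self _)
  filter_upwards [e1, e2] with ζ h1 h2
  rw [g_eq a ha ζ h2 h1]
  simp only [Function.comp]
  congr 1
  have hc : ∀ n : ℕ, (catalan (n + 1) : ℂ) / (n + 1) * ((a : ℂ) / 4 * ζ⁻¹) ^ (n + 1)
      = (fun j : ℕ => ((2 * (2 * j - 1)! / ((j + 1) * (j !) ^ 2) : ℝ) : ℂ) * (a : ℂ) ^ j
                / (4 ^ j * ζ ^ j)) (n + 1) := by
    intro n
    have := cat_coef n
    simp only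
    rw [← this, mul_pow, div_pow, inv_pow]
    push_cast
    rw [div_mul_eq_mul_div, mul_div_assoc, div_mul_eq_mul_div, div_mul_eq_mul_div]
    ring
  rw [Finset.sum_congr rfl fun n _ => hc n, Finset.range_eq_Ico,
    Finset.sum_Ico_add' (fun j : ℕ => ((2 * (2 * j - 1)! / ((j + 1) * (j !) ^ 2) : ℝ) : ℂ)
      * (a : ℂ) ^ j / (4 ^ j * ζ ^ j))]
  rfl

/-- Asymptotic expansion of `g` at infinity on `ℂ \ (-∞, a]`:
for every `M`, `g(ζ) = ln ζ - Σ_{j=1}^{M} (2(2j-1)!/((j+1)(j!)²)) a^j/(4^j ζ^j) + O(ζ^{-(M+1)})`;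
in particular `g(ζ) = ln ζ - a/(4ζ) - a²/(16ζ²) - 5a³/(192ζ³) + O(ζ^{-4})`. -/
theorem g_asymptotic_expansion (a : ℝ) (ha : 0 < a) :
    (∀ M : ℕ,
      (fun ζ : ℂ => gFun a ζ - Complex.log ζ
          + ∑ j ∈ Finset.Icc 1 M,
              ((2 * (2 * j - 1)! / ((j + 1) * (j !) ^ 2) : ℝ) : ℂ) * (a : ℂ) ^ j
                / (4 ^ j * ζ ^ j))
        =O[Bornology.cobounded ℂ ⊓ Filter.principal {ζ : ℂ | ζ.im ≠ 0 ∨ a < ζ.re}]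
          fun ζ : ℂ => ζ ^ (-(M : ℤ) - 1)) ∧
    (fun ζ : ℂ => gFun a ζ - Complex.log ζ + (a : ℂ) / (4 * ζ) + (a : ℂ) ^ 2 / (16 * ζ ^ 2)
          + 5 * (a : ℂ) ^ 3 / (192 * ζ ^ 3))
      =O[Bornology.cobounded ℂ ⊓ Filter.principal {ζ : ℂ | ζ.im ≠ 0 ∨ a < ζ.re}]
        fun ζ : ℂ => ζ ^ (-4 : ℤ) := by
  
  refine ⟨main_exp a ha, ?_⟩
  have h := main_exp a ha 3
  refine (h.congr_left fun ζ => ?_).congr_right fun ζ => by norm_num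
  rw [show Finset.Icc 1 3 = {1, 2, 3} by decide]
  simp [Nat.factorial]
  ring
end

section
/- The function δ(λ) defined by δ(λ) = exp{ (R(λ)/(2πi)) ∫_0^1 ln√s / ((s−λ) R_+(s)) ds } with R(λ) = √(λ(λ−1)) equals the algebraic expression (λ/(2λ − 1 + 2√(λ(λ−1))))^{1/4} for λ ∈ ℂ \ [0,1]. -/
open Complex

/-- The branch of `R(λ) = √(λ(λ - 1))` with cut `[0, 1]` that behaves like `λ` as `λ → +∞`. -/
noncomputable def sqrtBranch1 (l : ℂ) : ℂ :=
  l * (1 - 1 / l) ^ ((1 : ℂ) / 2)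

/-- The algebraic expression `(λ/(2λ - 1 + 2√(λ(λ-1))))^{1/4}`. -/
noncomputable def deltaFun (l : ℂ) : ℂ :=
  (l / (2 * l - 1 + 2 * sqrtBranch1 l)) ^ ((1 : ℂ) / 4)

/-- Poisson-type kernel, analytic in `u`. -/
noncomputable def poisK (u : ℂ) (t : ℝ) : ℂ :=
  (1 - u ^ 2) / (1 - 2 * u * (Real.cos t : ℂ) + u ^ 2)

lemma poisK_denom (u : ℂ) (t : ℝ) :
    (circleMap 0 1 t - u) * (1 - u * circleMap 0 1 t)
      = circleMap 0 1 t * (1 - 2 * u * (Real.cos t : ℂ) + u ^ 2) := by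
  have h1 : circleMap 0 1 t = Complex.cos t + Complex.sin t * I := by
    simp [circleMap, Complex.exp_mul_I]
  have h2 := Complex.sin_sq_add_cos_sq (t : ℂ)
  rw [h1, Complex.ofReal_cos]
  linear_combination u * h2 - u * (Complex.sin t) ^ 2 * Complex.I_sq

lemma norm_cm (t : ℝ) : ‖circleMap 0 1 t‖ = 1 := by simp

lemma one_sub_ne {u z : ℂ} (hu : ‖u‖ < 1) (hz : ‖z‖ ≤ 1) : 1 - u * z ≠ 0 := by
  intro h
  have h1 : u * z = 1 := (sub_eq_zero.mp h).symm
  have h2 : ‖u * z‖ = 1 := by rw [h1]; simp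
  rw [norm_mul] at h2
  nlinarith [norm_nonneg u, norm_nonneg z]

lemma poisK_denom_ne {u : ℂ} (hu : ‖u‖ < 1) (t : ℝ) :
    (1 - 2 * u * (Real.cos t : ℂ) + u ^ 2) ≠ 0 := by
  intro h
  have h1 := poisK_denom u t
  rw [h, mul_zero] at h1
  rcases mul_eq_zero.mp h1 with h2 | h2
  · have h3 := norm_cm t
    rw [sub_eq_zero.mp h2] at h3
    linarith
  · exact one_sub_ne hu (norm_cm t).le h2

lemma poisK_cont {u : ℂ} (hu : ‖u‖ < 1) : Continuous (poisK u) := by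
  unfold poisK
  refine Continuous.div (by fun_prop) (by fun_prop) (poisK_denom_ne hu)

lemma poisK_cauchy {u : ℂ} (hu : ‖u‖ < 1) {f : ℂ → ℂ}
    (hf : DiffContOnCl ℂ f (Metric.ball 0 1)) :
    ∫ t in (0 : ℝ)..(2 * Real.pi), f (circleMap 0 1 t) * poisK u t = 2 * Real.pi * f u := by
  have hg : DiffContOnCl ℂ (fun z => ((1 - u ^ 2) / (1 - u * z)) • f z) (Metric.ball 0 1) := by
    refine DiffContOnCl.smul ?_ hf
    apply DifferentiableOn.diffContOnCl
    rw [closure_ball _ one_ne_zero]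
    intro z hz
    have : 1 - u * z ≠ 0 := one_sub_ne hu (by simpa using hz)
    fun_prop (disch := assumption)
  have h := hg.circleIntegral_sub_inv_smul (w := u) (by simpa using hu)
  have hu2 : 1 - u ^ 2 ≠ 0 := by rw [sq]; exact one_sub_ne hu hu.le
  rw [circleIntegral] at h
  have e : ∀ t : ℝ, deriv (circleMap 0 1) t • ((circleMap 0 1 t - u)⁻¹ •
      ((1 - u ^ 2) / (1 - u * circleMap 0 1 t)) • f (circleMap 0 1 t))
      = I * (f (circleMap 0 1 t) * poisK u t) := by
    intro t
    have h1 := poisK_denom u t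
    have h2 := poisK_denom_ne hu t
    have h3 : circleMap 0 1 t ≠ 0 := by
      intro h; have := norm_cm t; rw [h] at this; simp at this
    have h4 : (circleMap 0 1 t - u) * (1 - u * circleMap 0 1 t) ≠ 0 := by
      rw [h1]; exact mul_ne_zero h3 h2
    have h5 := left_ne_zero_of_mul h4
    have h6 := right_ne_zero_of_mul h4
    simp only [deriv_circleMap, smul_eq_mul, poisK]
    generalize circleMap 0 1 t = z at *
    generalize f z = w
    rw [show z * I * ((z - u)⁻¹ * ((1 - u ^ 2) / (1 - u * z) * w))
      = I * w * (1 - u ^ 2) * (z / ((z - u) * (1 - u * z))) by field_simp]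
    rw [h1]
    field_simp
  simp only [e] at h
  rw [intervalIntegral.integral_const_mul] at h
  have h7 : 1 - u * u ≠ 0 := by rwa [← sq]
  have h8 : I * (∫ t in (0 : ℝ)..(2 * Real.pi), f (circleMap 0 1 t) * poisK u t)
      = I * (2 * Real.pi * f u) := by
    rw [h]
    simp only [smul_eq_mul]
    rw [sq, div_self h7]
    ring
  exact mul_left_cancel₀ I_ne_zero h8

lemma cm_refl (t : ℝ) : circleMap 0 1 (2 * Real.pi - t) = (starRingEnd ℂ) (circleMap 0 1 t) := by
  simp only [circleMap, Complex.exp_mul_I, ofReal_one, one_mul, zero_add, map_add, map_mul,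
    conj_I, ← Complex.ofReal_cos, ← Complex.ofReal_sin, Complex.conj_ofReal,
    Real.cos_two_pi_sub, Real.sin_two_pi_sub]
  push_cast
  ring

lemma poisK_refl (u : ℂ) (t : ℝ) : poisK u (2 * Real.pi - t) = poisK u t := by
  simp [poisK, Real.cos_two_pi_sub]

lemma re_pos_of {r : ℝ} {z : ℂ} (hr0 : 0 ≤ r) (hr : r < 1) (hz : ‖z‖ ≤ 1) :
    0 < (1 + r * z).re := by
  have h1 := (abs_le.mp (Complex.abs_re_le_norm z)).1
  simp
  nlinarith

lemma poisK_r {u : ℂ} (hu : ‖u‖ < 1) {r : ℝ} (hr0 : 0 ≤ r) (hr : r < 1) :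
    ∫ t in (0 : ℝ)..(2 * Real.pi),
      ((Real.log ‖1 + r * circleMap 0 1 t‖ - Real.log 2 : ℝ) : ℂ) * poisK u t
      = 2 * Real.pi * (Complex.log (1 + r * u) - Real.log 2) := by
  set f : ℂ → ℂ := fun z => Complex.log (1 + r * z) - Real.log 2 with hfdef
  have hsl : ∀ z : ℂ, ‖z‖ ≤ 1 → 1 + r * z ∈ slitPlane := fun z hz =>
    Or.inl (re_pos_of hr0 hr hz)
  have hf : DiffContOnCl ℂ f (Metric.ball 0 1) := by
    apply DifferentiableOn.diffContOnCl
    rw [closure_ball _ one_ne_zero]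
    intro z hz
    have := hsl z (by simpa using hz)
    simp only [hfdef]
    fun_prop (disch := assumption)
  have h1 := poisK_cauchy hu hf
  have hconj : ∀ z : ℂ, ‖z‖ ≤ 1 → f ((starRingEnd ℂ) z) = (starRingEnd ℂ) (f z) := by
    intro z hz
    simp only [hfdef, map_sub, Complex.conj_ofReal]
    rw [← Complex.log_conj _ (mem_slitPlane_iff_arg.mp (hsl z hz)).1]
    simp
  have h2 : ∫ t in (0 : ℝ)..(2 * Real.pi), (starRingEnd ℂ) (f (circleMap 0 1 t)) * poisK u t
      = 2 * Real.pi * f u := by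
    rw [← h1]
    have := intervalIntegral.integral_comp_sub_left (a := 0) (b := 2 * Real.pi)
      (fun t => f (circleMap 0 1 t) * poisK u t) (2 * Real.pi)
    simp only [sub_self, sub_zero] at this
    rw [← this]
    simp only [cm_refl, poisK_refl]
    simp only [hconj _ (norm_cm _).le]
  have hfc : Continuous (fun t : ℝ => f (circleMap 0 1 t)) := by
    simp only [hfdef]
    refine Continuous.sub (Continuous.clog ?_ (fun t => hsl _ (norm_cm t).le)) (by fun_prop)
    have := continuous_circleMap 0 1
    fun_prop
  have hk := poisK_cont hu
  have h3 := intervalIntegral.integral_add (μ := MeasureTheory.volume)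
    (a := 0) (b := 2 * Real.pi) (f := fun t => f (circleMap 0 1 t) * poisK u t)
    (g := fun t => (starRingEnd ℂ) (f (circleMap 0 1 t)) * poisK u t)
    ((hfc.mul hk).intervalIntegrable _ _)
    (((Complex.continuous_conj.comp hfc).mul hk).intervalIntegrable _ _)
  rw [h1, h2] at h3
  have h4 : ∀ t : ℝ, f (circleMap 0 1 t) * poisK u t
      + (starRingEnd ℂ) (f (circleMap 0 1 t)) * poisK u t
      = 2 * (((Real.log ‖1 + r * circleMap 0 1 t‖ - Real.log 2 : ℝ) : ℂ) * poisK u t) := by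
    intro t
    rw [← add_mul, Complex.add_conj]
    simp only [hfdef, Complex.sub_re, Complex.log_re, Complex.ofReal_re]
    push_cast
    ring
  simp only [h4] at h3
  rw [intervalIntegral.integral_const_mul] at h3
  linear_combination h3 / 2

lemma logInt : IntervalIntegrable (fun t : ℝ => Real.log ‖1 + circleMap 0 1 t‖)
    MeasureTheory.volume 0 (2 * Real.pi) := by
  have h := circleIntegrable_log_norm_sub_const (a := -1) (c := 0) 1
  simp only [CircleIntegrable, sub_neg_eq_add] at h
  simpa [add_comm] using h

lemma norm_lower {r : ℝ} {z : ℂ} (hr0 : 0 ≤ r) (hr : r < 1) (hz : ‖z‖ = 1) :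
    ‖1 + z‖ ≤ 2 * ‖1 + r * z‖ := by
  have h1 : 1 - r ≤ ‖1 + r * z‖ := by
    have := norm_sub_norm_le (1 : ℂ) (-(r * z))
    simpa [hz, abs_of_nonneg hr0] using this
  have h2 : ‖1 + z‖ ≤ ‖1 + r * z‖ + (1 - r) := by
    have e : 1 + z = (1 + r * z) + ((1 - r : ℝ) : ℂ) * z := by push_cast; ring
    rw [e]
    refine (norm_add_le _ _).trans ?_
    rw [norm_mul, hz, mul_one, Complex.norm_real, Real.norm_of_nonneg (by linarith)]
  linarith

lemma log_bound {r : ℝ} {z : ℂ} (hr0 : 0 ≤ r) (hr : r < 1) (hz : ‖z‖ = 1) (hz1 : 1 + z ≠ 0) :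
    |Real.log ‖1 + r * z‖| ≤ 2 * Real.log 2 + |Real.log ‖1 + z‖| := by
  have h0 : 0 < ‖1 + z‖ := norm_pos_iff.mpr hz1
  have h1 := norm_lower hr0 hr hz
  have h2 : 0 < ‖1 + r * z‖ := by linarith
  have h3 : ‖1 + r * z‖ ≤ 2 := by
    refine (norm_add_le _ _).trans ?_
    simp [hz, abs_of_nonneg hr0]; linarith
  have h4 := Real.log_le_log h2 h3
  have h5 := Real.log_le_log h0 h1
  rw [Real.log_mul (by norm_num) h2.ne'] at h5
  have h6 := Real.log_pos (x := 2) (by norm_num)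
  have h7 := neg_abs_le (Real.log ‖1 + z‖)
  have h8 := abs_nonneg (Real.log ‖1 + z‖)
  rw [abs_le]
  constructor <;> linarith

open MeasureTheory Set Filter Topology Interval in
lemma poisK_one {u : ℂ} (hu : ‖u‖ < 1) :
    ∫ t in (0 : ℝ)..(2 * Real.pi),
      ((Real.log ‖1 + circleMap 0 1 t‖ - Real.log 2 : ℝ) : ℂ) * poisK u t
      = 2 * Real.pi * (Complex.log (1 + u) - Real.log 2) := by
  have hne : ∀ᵐ t : ℝ, t ∈ Ι 0 (2 * Real.pi) → 1 + circleMap 0 1 t ≠ 0 := by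
    have : ∀ᵐ t : ℝ, t ≠ Real.pi := by
      simp [ae_iff]
    filter_upwards [this] with t ht hmem h
    rw [uIoc_of_le (by positivity)] at hmem
    have h1 : 1 + Real.cos t = 0 := by
      have := congrArg Complex.re h
      simpa [circleMap, Complex.exp_ofReal_mul_I_re] using this
    have h2 : Real.cos (t - Real.pi) = 1 := by rw [Real.cos_sub_pi]; linarith
    have := (Real.cos_eq_one_iff_of_lt_of_lt (x := t - Real.pi)
      (by linarith [hmem.1, Real.pi_pos]) (by linarith [hmem.2, Real.pi_pos])).mp h2
    exact ht (by linarith)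
  obtain ⟨M, hM⟩ := (isCompact_uIcc (a := (0:ℝ)) (b := 2 * Real.pi)).exists_bound_of_continuousOn
    (poisK_cont hu).continuousOn
  have hev : ∀ᶠ r : ℝ in 𝓝[<] 1, 0 ≤ r ∧ r < 1 := by
    have h1 : ∀ᶠ r : ℝ in 𝓝[<] 1, (0:ℝ) < r :=
      (lt_mem_nhds (by norm_num : (0:ℝ) < 1)).filter_mono nhdsWithin_le_nhds
    filter_upwards [h1, self_mem_nhdsWithin] with r hr hr'
    exact ⟨hr.le, hr'⟩
  have hcm := continuous_circleMap 0 1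
  have hlim := intervalIntegral.tendsto_integral_filter_of_dominated_convergence
    (μ := volume) (l := 𝓝[<] (1:ℝ)) (a := 0) (b := 2 * Real.pi)
    (F := fun r t => ((Real.log ‖1 + r * circleMap 0 1 t‖ - Real.log 2 : ℝ) : ℂ) * poisK u t)
    (f := fun t => ((Real.log ‖1 + circleMap 0 1 t‖ - Real.log 2 : ℝ) : ℂ) * poisK u t)
    (fun t => (2 * Real.log 2 + |Real.log ‖1 + circleMap 0 1 t‖| + Real.log 2) * M)
    (by
      refine Eventually.of_forall fun r => Measurable.aestronglyMeasurable ?_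
      have := (poisK_cont hu).measurable
      have := hcm.measurable
      fun_prop)
    (by
      filter_upwards [hev] with r hr
      filter_upwards [hne] with t ht hmem
      rw [norm_mul, Complex.norm_real, Real.norm_eq_abs]
      have h1 := log_bound hr.1 hr.2 (norm_cm t) (ht hmem)
      have h2 := abs_sub (Real.log ‖1 + r * circleMap 0 1 t‖) (Real.log 2)
      have h6 := Real.log_pos (x := 2) (by norm_num)
      rw [abs_of_pos h6] at h2
      refine mul_le_mul (by linarith) (hM t (uIoc_subset_uIcc hmem)) (norm_nonneg _) (by positivity))
    (by
      refine IntervalIntegrable.mul_const ?_ _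
      refine (IntervalIntegrable.add ?_ logInt.abs).add ?_ <;> simp)
    (by
      filter_upwards [hne] with t ht hmem
      have hc : ContinuousAt (fun r : ℝ =>
          ((Real.log ‖1 + r * circleMap 0 1 t‖ - Real.log 2 : ℝ) : ℂ) * poisK u t) 1 := by
        have : ‖1 + ((1:ℝ):ℂ) * circleMap 0 1 t‖ ≠ 0 := by simpa using ht hmem
        fun_prop (disch := assumption)
      have := hc.tendsto.mono_left (nhdsWithin_le_nhds (s := Iio 1))
      simpa using this)
  have hlim2 : Tendsto (fun r : ℝ => 2 * Real.pi * (Complex.log (1 + r * u) - Real.log 2))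
      (𝓝[<] (1:ℝ)) (𝓝 (2 * Real.pi * (Complex.log (1 + u) - Real.log 2))) := by
    have hc : ContinuousAt (fun r : ℝ => 2 * Real.pi * (Complex.log (1 + r * u) - Real.log 2))
        1 := by
      have : 1 + ((1:ℝ):ℂ) * u ∈ slitPlane := by
        simpa using Complex.mem_slitPlane_of_norm_lt_one hu
      fun_prop (disch := assumption)
    have := hc.tendsto.mono_left (nhdsWithin_le_nhds (s := Iio 1))
    simpa using this
  refine tendsto_nhds_unique hlim (hlim2.congr' ?_)
  filter_upwards [hev] with r hr
  exact (poisK_r hu hr.1 hr.2).symm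

open MeasureTheory in
lemma poisK_half {u : ℂ} (hu : ‖u‖ < 1) :
    ∫ t in (0 : ℝ)..Real.pi,
      ((Real.log ‖1 + circleMap 0 1 t‖ - Real.log 2 : ℝ) : ℂ) * poisK u t
      = Real.pi * (Complex.log (1 + u) - Real.log 2) := by
  have h := poisK_one hu
  set g : ℝ → ℂ := fun t =>
    ((Real.log ‖1 + circleMap 0 1 t‖ - Real.log 2 : ℝ) : ℂ) * poisK u t with hg
  have hi : IntervalIntegrable g volume 0 (2 * Real.pi) := by
    refine IntervalIntegrable.mul_continuousOn ?_ (poisK_cont hu).continuousOn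
    have : IntervalIntegrable (fun t : ℝ => Real.log ‖1 + circleMap 0 1 t‖ - Real.log 2)
      volume 0 (2 * Real.pi) := logInt.sub (by simp)
    exact ⟨this.1.ofReal, this.2.ofReal⟩
  have hpi := Real.pi_pos
  have h1 := intervalIntegral.integral_add_adjacent_intervals (μ := volume) (f := g)
    (a := 0) (b := Real.pi) (c := 2 * Real.pi)
    (hi.mono_set (by
      rw [Set.uIcc_of_le (by linarith), Set.uIcc_of_le (by linarith)]
      exact Set.Icc_subset_Icc le_rfl (by linarith)))
    (hi.mono_set (by
      rw [Set.uIcc_of_le (by linarith), Set.uIcc_of_le (by linarith)]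
      exact Set.Icc_subset_Icc (by linarith) le_rfl))
  have h2 := intervalIntegral.integral_comp_sub_left (a := 0) (b := Real.pi) g (2 * Real.pi)
  have h3 : ∀ t, g (2 * Real.pi - t) = g t := by
    intro t
    simp only [hg, poisK_refl, cm_refl]
    congr 4
    rw [← Complex.norm_conj]
    simp
  simp only [h3] at h2
  rw [show 2 * Real.pi - Real.pi = Real.pi by ring, sub_zero] at h2
  rw [← h2, h] at h1
  linear_combination h1 / 2

open MeasureTheory Set in
lemma subst_int (G : ℝ → ℂ) :
    ∫ s in (0 : ℝ)..1, G s
      = ∫ t in (0 : ℝ)..Real.pi, ((Real.sin t / 2 : ℝ) : ℂ) * G ((1 + Real.cos t) / 2) := by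
  have hpi := Real.pi_pos
  have himg : (fun t : ℝ => (1 + Real.cos t) / 2) '' Ioo 0 Real.pi = Ioo 0 1 := by
    ext s
    constructor
    · rintro ⟨t, ht, rfl⟩
      have h1 : Real.cos t < 1 := by
        rw [← Real.cos_zero]
        exact Real.cos_lt_cos_of_nonneg_of_le_pi le_rfl ht.2.le ht.1
      have h2 : -1 < Real.cos t := by
        rw [← Real.cos_pi]
        exact Real.cos_lt_cos_of_nonneg_of_le_pi ht.1.le le_rfl ht.2
      constructor <;> simp only <;> linarith
    · rintro ⟨h0, h1⟩
      refine ⟨Real.arccos (2 * s - 1), ⟨Real.arccos_pos.mpr (by linarith), ?_⟩, ?_⟩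
      · refine lt_of_le_of_ne (Real.arccos_le_pi _) fun h => ?_
        rw [Real.arccos_eq_pi] at h
        linarith
      · simp only
        rw [Real.cos_arccos (by linarith) (by linarith)]; ring
  have key := integral_image_eq_integral_abs_deriv_smul (s := Ioo 0 Real.pi)
    (f := fun t : ℝ => (1 + Real.cos t) / 2) (f' := fun t => (-Real.sin t) / 2)
    measurableSet_Ioo
    (fun t _ => (((Real.hasDerivAt_cos t).const_add 1).div_const 2).hasDerivWithinAt)
    (fun a ha b hb hab => Real.injOn_cos (Ioo_subset_Icc_self ha) (Ioo_subset_Icc_self hb)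
      (by simp only at hab; linarith)) G
  rw [himg] at key
  rw [intervalIntegral.integral_of_le zero_le_one, intervalIntegral.integral_of_le hpi.le,
    integral_Ioc_eq_integral_Ioo, integral_Ioc_eq_integral_Ioo, key]
  refine setIntegral_congr_fun measurableSet_Ioo fun t ht => ?_
  have := Real.sin_pos_of_mem_Ioo ht
  simp only [neg_div, abs_neg, abs_of_pos (half_pos this), Complex.real_smul]

lemma norm_one_add_cm (t : ℝ) :
    ‖1 + circleMap 0 1 t‖ = 2 * Real.sqrt ((1 + Real.cos t) / 2) := by
  have h1 : ‖1 + circleMap 0 1 t‖ ^ 2 = 2 + 2 * Real.cos t := by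
    rw [← Complex.normSq_eq_norm_sq, Complex.normSq_apply]
    simp [circleMap, Complex.exp_ofReal_mul_I_re, Complex.exp_ofReal_mul_I_im]
    nlinarith [Real.sin_sq_add_cos_sq t]
  rw [← Real.sqrt_sq (norm_nonneg (1 + circleMap 0 1 t)), h1,
    show 2 + 2 * Real.cos t = 2 ^ 2 * ((1 + Real.cos t) / 2) by ring,
    Real.sqrt_mul (by norm_num), Real.sqrt_sq (by norm_num)]

open MeasureTheory Set in
lemma main_int {u : ℂ} (hu : ‖u‖ < 1) (hu0 : u ≠ 0) {l R : ℂ}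
    (hl : l = (1 + u) ^ 2 / (4 * u)) (hR : R = (1 - u ^ 2) / (4 * u)) :
    (R / (2 * Real.pi * Complex.I)) *
        ∫ s in (0 : ℝ)..1,
          ((Real.log (Real.sqrt s) : ℝ) : ℂ) /
            (((s : ℂ) - l) * (Complex.I * (Real.sqrt (s * (1 - s)) : ℂ)))
      = (Complex.log (1 + u) - Real.log 2) / 2 := by
  have hpi := Real.pi_pos
  have hpi' : (Real.pi : ℂ) ≠ 0 := by exact_mod_cast hpi.ne'
  rw [subst_int, ← intervalIntegral.integral_const_mul]
  have : ∀ c : ℂ, (1 / (2 * Real.pi) : ℂ) * (Real.pi * c) = c / 2 := by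
    intro c; field_simp
  rw [← this, ← poisK_half hu, ← intervalIntegral.integral_const_mul]
  rw [intervalIntegral.integral_of_le hpi.le, intervalIntegral.integral_of_le hpi.le,
    integral_Ioc_eq_integral_Ioo, integral_Ioc_eq_integral_Ioo]
  refine setIntegral_congr_fun measurableSet_Ioo fun t ht => ?_
  have hs := Real.sin_pos_of_mem_Ioo ht
  have hc : 0 < (1 + Real.cos t) / 2 := by
    have : -1 < Real.cos t := by
      rw [← Real.cos_pi]
      exact Real.cos_lt_cos_of_nonneg_of_le_pi ht.1.le le_rfl ht.2
    linarith
  have e1 : Real.sqrt ((1 + Real.cos t) / 2 * (1 - (1 + Real.cos t) / 2)) = Real.sin t / 2 := by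
    rw [← Real.sqrt_sq (half_pos hs).le]
    congr 1
    nlinarith [Real.sin_sq_add_cos_sq t]
  have e2 : Real.log ‖1 + circleMap 0 1 t‖ - Real.log 2
      = Real.log (Real.sqrt ((1 + Real.cos t) / 2)) := by
    rw [norm_one_add_cm, Real.log_mul (by norm_num) (Real.sqrt_pos.mpr hc).ne']
    ring
  rw [e1, e2]
  have hd := poisK_denom_ne hu t
  have hs' : ((Real.sin t / 2 : ℝ) : ℂ) ≠ 0 := by exact_mod_cast (half_pos hs).ne'
  have e3 : (((1 + Real.cos t) / 2 : ℝ) : ℂ) - l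
      = -(1 - 2 * u * (Real.cos t : ℂ) + u ^ 2) / (4 * u) := by
    rw [hl]; push_cast; field_simp; ring
  rw [e3, hR, poisK]
  generalize ((Real.sin t / 2 : ℝ) : ℂ) = a at *
  generalize ((Real.log (Real.sqrt ((1 + Real.cos t) / 2)) : ℝ) : ℂ) = b at *
  generalize 1 - 2 * u * (Real.cos t : ℂ) + u ^ 2 = d at *
  field_simp
  rw [Complex.I_sq]
  ring

/-- The Szegő-type integral representation
`δ(λ) = exp{ (R(λ)/(2πi)) ∫_0^1 ln√s / ((s-λ) R₊(s)) ds }`, where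
`R₊(s) = i√(s(1-s))` is the boundary value of `R` from above, coincides with the algebraic
expression `(λ/(2λ - 1 + 2√(λ(λ-1))))^{1/4}` on `ℂ \ [0,1]`. -/
theorem delta_integral_representation (l : ℂ) (hl : l.im ≠ 0 ∨ l.re < 0 ∨ 1 < l.re) :
    Complex.exp ((sqrtBranch1 l / (2 * Real.pi * Complex.I)) *
        ∫ s in (0 : ℝ)..1,
          ((Real.log (Real.sqrt s) : ℝ) : ℂ) /
            (((s : ℂ) - l) * (Complex.I * (Real.sqrt (s * (1 - s)) : ℂ))))
      = deltaFun l := by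
  have hl0 : l ≠ 0 := by
    rintro rfl
    norm_num at hl
  have hsl : 1 - 1 / l ∈ slitPlane := by
    rw [mem_slitPlane_iff]
    by_cases him : l.im = 0
    · left
      have e : l = (l.re : ℂ) := Complex.ext (by simp) (by simp [him])
      rw [e, ← Complex.ofReal_one, ← Complex.ofReal_div, ← Complex.ofReal_sub, Complex.ofReal_re]
      rcases hl with h | h | h
      · exact absurd him h
      · have : 1 / l.re < 0 := one_div_neg.mpr h
        linarith
      · have : 1 / l.re < 1 := by rw [div_lt_one (by linarith)]; exact h
        linarith
    · right
      have hn : Complex.normSq l ≠ 0 := by simpa using hl0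
      simp [Complex.inv_im, him, hl0]
  set c : ℂ := (1 - 1 / l) ^ ((1 : ℂ) / 2) with hc
  have hne := slitPlane_ne_zero hsl
  have hc2 : c ^ 2 = 1 - 1 / l := by
    rw [hc, ← Complex.cpow_nat_mul]
    simp
  have hcre : 0 < c.re := by
    rw [hc, Complex.cpow_def_of_ne_zero hne, Complex.exp_re]
    refine mul_pos (Real.exp_pos _) (Real.cos_pos_of_mem_Ioo ?_)
    have e : (Complex.log (1 - 1 / l) * (1 / 2)).im = Complex.arg (1 - 1 / l) / 2 := by
      rw [show (1 / 2 : ℂ) = ((1 / 2 : ℝ) : ℂ) by norm_num, Complex.im_mul_ofReal, Complex.log_im]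
      ring
    rw [e]
    have h1 := Complex.neg_pi_lt_arg (1 - 1 / l)
    have h2 := lt_of_le_of_ne (Complex.arg_le_pi (1 - 1 / l)) (mem_slitPlane_iff_arg.mp hsl).1
    constructor <;> linarith
  have h1c : 1 + c ≠ 0 := by
    intro h
    have := congrArg Complex.re h
    simp at this
    linarith
  have hlc : l * (1 - c ^ 2) = 1 := by rw [hc2]; field_simp; ring
  have h1c' : 1 - c ≠ 0 := by
    intro h
    have : c = 1 := (sub_eq_zero.mp h).symm
    rw [this] at hlc
    norm_num at hlc
  have hl' : l = 1 / ((1 - c) * (1 + c)) := by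
    rw [eq_div_iff (mul_ne_zero h1c' h1c)]
    linear_combination hlc
  set u : ℂ := (1 - c) / (1 + c) with hu
  have hu0 : u ≠ 0 := div_ne_zero h1c' h1c
  have hun : ‖u‖ < 1 := by
    rw [hu, norm_div, div_lt_one (norm_pos_iff.mpr h1c)]
    refine lt_of_pow_lt_pow_left₀ 2 (norm_nonneg _) ?_
    rw [← Complex.normSq_eq_norm_sq, ← Complex.normSq_eq_norm_sq, Complex.normSq_apply,
      Complex.normSq_apply]
    simp
    nlinarith
  have h1u : 1 + u = 2 / (1 + c) := by rw [hu]; field_simp; ring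
  have hR : sqrtBranch1 l = l * c := rfl
  have hm := main_int (l := l) (R := sqrtBranch1 l) hun hu0
    (by rw [h1u, hl', hu]; field_simp; ring) (by rw [hR, hl', hu]; field_simp; ring)
  rw [hm, deltaFun]
  have hre : 0 < (1 + u).re := by
    have h1 := (abs_le.mp (Complex.abs_re_le_norm u)).1
    simp
    linarith
  have h1u0 : 1 + u ≠ 0 := by
    intro h; rw [h] at hre; simp at hre
  have hq : l / (2 * l - 1 + 2 * sqrtBranch1 l) = (1 + u) ^ 2 / 4 := by
    have e : 2 * l - 1 + 2 * sqrtBranch1 l = (1 + c) / (1 - c) := by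
      rw [hR, hl']; field_simp; ring
    rw [e, h1u, hl']
    field_simp
    ring
  have hexp : (1 + u) ^ 2 / 4 = Complex.exp (2 * (Complex.log (1 + u) - Real.log 2)) := by
    rw [two_mul, Complex.exp_add, Complex.exp_sub, Complex.exp_log h1u0, ← Complex.ofReal_exp,
      Real.exp_log (by norm_num)]
    push_cast
    ring
  have harg := abs_lt.mp (Complex.abs_arg_lt_pi_div_two_iff.mpr (Or.inl hre))
  have him : (2 * (Complex.log (1 + u) - Real.log 2)).im = 2 * Complex.arg (1 + u) := by
    rw [show (2 : ℂ) = ((2 : ℝ) : ℂ) by norm_num, Complex.im_ofReal_mul, Complex.sub_im,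
      Complex.log_im, Complex.ofReal_im, sub_zero]
  rw [hq, hexp, Complex.cpow_def_of_ne_zero (Complex.exp_ne_zero _),
    Complex.log_exp (by rw [him]; linarith) (by rw [him]; linarith)]
  congr 1
  ring
end

section
/- The left-reflection kernel estimate: let q_0 : ℝ → ℝ be bounded with q_0(x) → c as x → −∞, c > 0, and ∫_{−∞}^0 (1+|x|)|q_0(x) − c| dx < ∞. Set σ_l(x) = ∫_{−∞}^x |q_0(s) − c| ds. Then the solution H_2(u,v) of the integral equation H_2(u,v) = −(q_0(u)−c)/2 + ∫_0^v (q_0(u+ṽ)−c) ∫_{−∞}^u (q_0(ũ+ṽ)+c) H_2(ũ,ṽ) dũ dṽ exists (by successive approximations) and satisfies |H_2(u,v)| ≤ |q_0(u)−c|/2 + σ_l(u)·(σ_l(u+v) − σ_l(u))/2 · M₂ · exp[M₂·(σ_{l,1}(u+v) − σ_{l,1}(u))], where M₂ = sup_{z≤u+v}|q_0(z)+c| and σ_{l,1}(x) = ∫_{−∞}^x σ_l(s) ds. -/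
open MeasureTheory Filter

/-- Cumulative integral from minus infinity. -/
noncomputable def cumInt (w : ℝ → ℝ) (x : ℝ) : ℝ := ∫ s in Set.Iic x, w s

/-- Successive approximations. -/
noncomputable def iterH (p r : ℝ → ℝ) : ℕ → ℝ → ℝ → ℝ
  | 0 => fun u _ => -(p u) / 2
  | n + 1 => fun u v => ∫ b in Set.Ioc 0 v, p (u + b) * ∫ a in Set.Iic u, r (a + b) * iterH p r n a b

lemma cumInt_sub {w : ℝ → ℝ} (hw : ∀ x, IntegrableOn w (Set.Iic x)) (a b : ℝ) :
    cumInt w b - cumInt w a = ∫ x in a..b, w x :=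
  intervalIntegral.integral_Iic_sub_Iic (hw a) (hw b)

lemma ii_of {w : ℝ → ℝ} (hw : ∀ x, IntegrableOn w (Set.Iic x)) (a b : ℝ) :
    IntervalIntegrable w volume a b :=
  ⟨(hw b).mono_set Set.Ioc_subset_Iic_self, (hw a).mono_set Set.Ioc_subset_Iic_self⟩

lemma cumInt_eq {w : ℝ → ℝ} (hw : ∀ x, IntegrableOn w (Set.Iic x)) (a : ℝ) :
    cumInt w = fun b => cumInt w a + ∫ x in a..b, w x := by
  funext b
  have := cumInt_sub hw a b
  linarith

lemma cumInt_cont {w : ℝ → ℝ} (hw : ∀ x, IntegrableOn w (Set.Iic x)) :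
    Continuous (cumInt w) := by
  rw [cumInt_eq hw 0]
  exact continuous_const.add (intervalIntegral.continuous_primitive (ii_of hw) 0)

lemma cumInt_nonneg {w : ℝ → ℝ} (h0 : ∀ x, 0 ≤ w x) (x : ℝ) : 0 ≤ cumInt w x :=
  integral_nonneg h0

lemma cumInt_mono {w : ℝ → ℝ} (hw : ∀ x, IntegrableOn w (Set.Iic x)) (h0 : ∀ x, 0 ≤ w x) :
    Monotone (cumInt w) := by
  intro a b hab
  have := cumInt_sub hw a b
  have h2 : 0 ≤ ∫ x in a..b, w x := intervalIntegral.integral_nonneg hab (fun x _ => h0 x)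
  linarith

lemma cumInt_hasDerivAt {w : ℝ → ℝ} (hw : ∀ x, IntegrableOn w (Set.Iic x)) (hc : Continuous w)
    (x : ℝ) : HasDerivAt (cumInt w) (w x) x := by
  rw [cumInt_eq hw 0]
  exact (intervalIntegral.integral_hasDerivAt_right (ii_of hw 0 x)
    (hc.stronglyMeasurableAtFilter _ _) hc.continuousAt).const_add _

lemma cumInt_tendsto {w : ℝ → ℝ} (hw : ∀ x, IntegrableOn w (Set.Iic x)) :
    Tendsto (cumInt w) atBot (nhds 0) := by
  have h := intervalIntegral_tendsto_integral_Iic 0 (hw 0) (tendsto_id (x := atBot))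
  have h2 := h.const_sub (cumInt w 0)
  have e : cumInt w 0 - ∫ x in Set.Iic 0, w x = 0 := sub_self _
  rw [e] at h2
  refine h2.congr fun x => ?_
  have := cumInt_sub hw x 0
  simp only [id]
  linarith

lemma shift_int {w : ℝ → ℝ} (hw : ∀ x, IntegrableOn w (Set.Iic x)) (v u : ℝ) :
    IntegrableOn (fun a => w (a + v)) (Set.Iic u) := by
  have h := ((measurePreserving_add_right volume v).integrableOn_comp_preimage
    (MeasurableEquiv.addRight v).measurableEmbedding (f := w) (s := Set.Iic (u + v))).2 (hw _)
  have e : (fun x => x + v) ⁻¹' Set.Iic (u + v) = Set.Iic u := by ext; simp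
  rw [e] at h
  exact h

lemma cumInt_integrable {w : ℝ → ℝ} (hm : Measurable w) (h0 : ∀ x, 0 ≤ w x)
    (hw : ∀ x, IntegrableOn w (Set.Iic x))
    (h1 : IntegrableOn (fun x => (-x) * w x) (Set.Iic 0)) (x : ℝ) :
    IntegrableOn (cumInt w) (Set.Iic x) := by
  have base : IntegrableOn (cumInt w) (Set.Iic 0) := by
    have key : Integrable (fun z : ℝ × ℝ => Set.indicator {z : ℝ × ℝ | z.2 ≤ z.1} (fun z => w z.2) z)
        ((volume.restrict (Set.Iic (0:ℝ))).prod (volume.restrict (Set.Iic (0:ℝ)))) := by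
      have hms : MeasurableSet {z : ℝ × ℝ | z.2 ≤ z.1} := measurableSet_le measurable_snd measurable_fst
      have hms2 : Measurable (fun z : ℝ × ℝ => Set.indicator {z : ℝ × ℝ | z.2 ≤ z.1} (fun z => w z.2) z) :=
        (hm.comp measurable_snd).indicator hms
      rw [integrable_prod_iff' hms2.aestronglyMeasurable]
      have ef : ∀ y : ℝ, (fun x => Set.indicator {z : ℝ × ℝ | z.2 ≤ z.1} (fun z => w z.2) (x, y))
          = Set.indicator (Set.Ici y) (fun _ => w y) := by
        intro y; funext x; simp [Set.indicator]
      constructor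
      · refine Eventually.of_forall fun y => ?_
        rw [ef, integrable_indicator_iff measurableSet_Ici, IntegrableOn,
          Measure.restrict_restrict measurableSet_Ici]
        apply integrableOn_const
        · rw [Set.Ici_inter_Iic]; simp
        · simp
      · refine h1.congr ?_
        filter_upwards [ae_restrict_mem measurableSet_Iic] with y hy
        have : ∀ x, ‖Set.indicator {z : ℝ × ℝ | z.2 ≤ z.1} (fun z => w z.2) (x, y)‖
            = Set.indicator (Set.Ici y) (fun _ => w y) x := by
          intro x
          rw [congrFun (ef y) x, Real.norm_of_nonneg]
          exact Set.indicator_nonneg (fun _ _ => h0 y) x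
        simp_rw [this]
        rw [integral_indicator measurableSet_Ici, Measure.restrict_restrict measurableSet_Ici,
          Set.Ici_inter_Iic, setIntegral_const]
        simp only [Set.mem_Iic] at hy
        simp [Measure.real, hy]
    refine key.integral_prod_left.congr ?_
    filter_upwards [ae_restrict_mem measurableSet_Iic] with y hy
    have ef : (fun x => Set.indicator {z : ℝ × ℝ | z.2 ≤ z.1} (fun z => w z.2) (y, x))
          = Set.indicator (Set.Iic y) w := by
        funext x; simp [Set.indicator]
    rw [ef, integral_indicator measurableSet_Iic, Measure.restrict_restrict measurableSet_Iic,
      Set.inter_eq_left.2 (Set.Iic_subset_Iic.2 hy)]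
    rfl
  have h2 : IntegrableOn (cumInt w) (Set.Icc 0 x) := (cumInt_cont hw).continuousOn.integrableOn_Icc
  refine (base.union h2).mono_set ?_
  intro y hy
  rcases le_total y 0 with h | h
  · exact Or.inl h
  · exact Or.inr ⟨h, hy⟩

lemma iterH_meas {p r : ℝ → ℝ} (hp : Measurable p) (hr : Measurable r) (n : ℕ) :
    Measurable (fun z : ℝ × ℝ => iterH p r n z.1 z.2) ∧
    Measurable (fun z : ℝ × ℝ => ∫ a in Set.Iic z.1, r (a + z.2) * iterH p r n a z.2) := by
  have step : ∀ n, Measurable (fun z : ℝ × ℝ => iterH p r n z.1 z.2) →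
      Measurable (fun z : ℝ × ℝ => ∫ a in Set.Iic z.1, r (a + z.2) * iterH p r n a z.2) := by
    intro n h
    have hs : MeasurableSet {y : (ℝ × ℝ) × ℝ | y.2 ≤ y.1.1} :=
      measurableSet_le (by fun_prop) (by fun_prop)
    have hg : Measurable (fun y : (ℝ × ℝ) × ℝ => r (y.2 + y.1.2) * iterH p r n y.2 y.1.2) :=
      (hr.comp (by fun_prop)).mul (h.comp (g := fun z : ℝ × ℝ => iterH p r n z.1 z.2)
        (f := fun y : (ℝ × ℝ) × ℝ => (y.2, y.1.2)) (by fun_prop))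
    have := ((hg.indicator hs).stronglyMeasurable.integral_prod_right' (ν := volume)).measurable
    convert this using 1
    funext z
    rw [← integral_indicator measurableSet_Iic]
    rfl
  induction n with
  | zero =>
    have : Measurable (fun z : ℝ × ℝ => iterH p r 0 z.1 z.2) := by
      simp only [iterH]; fun_prop
    exact ⟨this, step 0 this⟩
  | succ n ih =>
    have : Measurable (fun z : ℝ × ℝ => iterH p r (n + 1) z.1 z.2) := by
      have hs : MeasurableSet {y : (ℝ × ℝ) × ℝ | 0 < y.2 ∧ y.2 ≤ y.1.2} :=
        MeasurableSet.inter (s₁ := {y : (ℝ × ℝ) × ℝ | 0 < y.2}) (s₂ := {y : (ℝ × ℝ) × ℝ | y.2 ≤ y.1.2})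
          (measurableSet_lt (by fun_prop) (by fun_prop))
          (measurableSet_le (by fun_prop) (by fun_prop))
      have hg : Measurable (fun y : (ℝ × ℝ) × ℝ => p (y.1.1 + y.2) *
          ∫ a in Set.Iic y.1.1, r (a + y.2) * iterH p r n a y.2) :=
        (hp.comp (by fun_prop)).mul (ih.2.comp (g := fun z : ℝ × ℝ => ∫ a in Set.Iic z.1, r (a + z.2) * iterH p r n a z.2)
          (f := fun y : (ℝ × ℝ) × ℝ => (y.1.1, y.2)) (by fun_prop))
      have := ((hg.indicator hs).stronglyMeasurable.integral_prod_right' (ν := volume)).measurable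
      convert this using 1
      funext z
      simp only [iterH]
      rw [← integral_indicator measurableSet_Ioc]
      rfl
    exact ⟨this, step _ this⟩

/-- The FTC step. -/
lemma ftc_step {S : ℝ → ℝ} (hS : ∀ x, IntegrableOn S (Set.Iic x)) (hc : Continuous S)
    (hm : Monotone S) {v : ℝ} (hv : 0 ≤ v) (n : ℕ) (u : ℝ) :
    IntegrableOn (fun a => (S (a + v) - S a) * (cumInt S (a + v) - cumInt S a) ^ n) (Set.Iic u) ∧
    ∫ a in Set.Iic u, (S (a + v) - S a) * (cumInt S (a + v) - cumInt S a) ^ n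
      = (cumInt S (u + v) - cumInt S u) ^ (n + 1) / (n + 1) := by
  have hd : ∀ a, HasDerivAt (fun a => cumInt S (a + v) - cumInt S a) (S (a + v) - S a) a := by
    intro a
    exact ((cumInt_hasDerivAt hS hc (a + v)).comp_add_const a v).sub (cumInt_hasDerivAt hS hc a)
  have hcA : Continuous (fun a => cumInt S (a + v) - cumInt S a) :=
    ((cumInt_cont hS).comp (by fun_prop)).sub (cumInt_cont hS)
  have ht : Tendsto (fun a => cumInt S (a + v) - cumInt S a) atBot (nhds 0) := by
    have := ((cumInt_tendsto hS).comp (tendsto_atBot_add_const_right atBot v tendsto_id)).sub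
      (cumInt_tendsto hS)
    simpa using this
  have hmA : Monotone (fun a => cumInt S (a + v) - cumInt S a) :=
    monotone_of_deriv_nonneg (fun a => (hd a).differentiableAt) (fun a => by
      rw [(hd a).deriv]; exact sub_nonneg.2 (hm (by linarith)))
  have h0A : ∀ a, 0 ≤ cumInt S (a + v) - cumInt S a := fun a => hmA.le_of_tendsto ht a
  have hI : IntegrableOn (fun a => (S (a + v) - S a) * (cumInt S (a + v) - cumInt S a) ^ n)
      (Set.Iic u) := by
    have h1 : IntegrableOn (fun a => S (a + v) - S a) (Set.Iic u) := (shift_int hS v u).sub (hS u)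
    refine Integrable.mul_bdd (c := (cumInt S (u + v) - cumInt S u) ^ n) h1 (hcA.pow n).aestronglyMeasurable ?_
    filter_upwards [ae_restrict_mem measurableSet_Iic] with a ha
    rw [Real.norm_of_nonneg (pow_nonneg (h0A a) n)]
    exact pow_le_pow_left₀ (h0A a) (hmA ha) n
  refine ⟨hI, ?_⟩
  have := integral_Iic_of_hasDerivAt_of_tendsto (a := u) (m := 0)
    (f := fun a => (cumInt S (a + v) - cumInt S a) ^ (n + 1) / (n + 1))
    (f' := fun a => (S (a + v) - S a) * (cumInt S (a + v) - cumInt S a) ^ n)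
    ((hcA.pow (n+1)).div_const _).continuousWithinAt
    (fun a _ => by
      have := ((hd a).pow (n + 1)).div_const ((n:ℝ) + 1)
      refine this.congr_deriv ?_
      have : (n:ℝ) + 1 ≠ 0 := by positivity
      simp only [Nat.add_sub_cancel]
      push_cast
      field_simp) hI (by
      have := (ht.pow (n+1)).div_const ((n:ℝ)+1)
      simpa using this)
  rw [this, sub_zero]

section Bounds

variable {p r : ℝ → ℝ} {M X : ℝ}

/-- increment of the iterated moment -/
noncomputable def incr (p : ℝ → ℝ) (u v : ℝ) : ℝ :=
  cumInt (cumInt fun s => |p s|) (u + v) - cumInt (cumInt fun s => |p s|) u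

lemma incr_nonneg (hS : ∀ x, IntegrableOn (cumInt fun s => |p s|) (Set.Iic x)) {u v : ℝ}
    (hv : 0 ≤ v) : 0 ≤ incr p u v :=
  sub_nonneg.2 (cumInt_mono hS (cumInt_nonneg fun _ => abs_nonneg _) (by linarith))

lemma incr_mono (hS : ∀ x, IntegrableOn (cumInt fun s => |p s|) (Set.Iic x)) {u b v : ℝ}
    (hv : b ≤ v) : incr p u b ≤ incr p u v :=
  sub_le_sub_right (cumInt_mono hS (cumInt_nonneg fun _ => abs_nonneg _) (by linarith)) _

lemma outer_int (hw : ∀ x, IntegrableOn (fun s => |p s|) (Set.Iic x)) (u : ℝ) {v : ℝ} (hv : 0 ≤ v) :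
    IntegrableOn (fun b => |p (u + b)|) (Set.Ioc 0 v) ∧
    ∫ b in Set.Ioc 0 v, |p (u + b)| = cumInt (fun s => |p s|) (u + v) - cumInt (fun s => |p s|) u := by
  constructor
  · have := (shift_int hw u v).mono_set (Set.Ioc_subset_Iic_self (a := 0))
    simpa only [add_comm] using this
  · rw [cumInt_sub hw, ← intervalIntegral.integral_of_le hv,
      intervalIntegral.integral_comp_add_left (fun s => |p s|), add_zero]

/-- bound for the inner integrals -/
def InnerB (p r : ℝ → ℝ) (M X : ℝ) (n : ℕ) : Prop :=
  ∀ u v : ℝ, 0 ≤ v → u + v ≤ X →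
    IntegrableOn (fun a => r (a + v) * iterH p r n a v) (Set.Iic u) ∧
    ∫ a in Set.Iic u, ‖r (a + v) * iterH p r n a v‖
      ≤ M * cumInt (fun s => |p s|) u / 2 * ((M * incr p u v) ^ n / n.factorial)

/-- bound for the outer integrals -/
def OuterB (p r : ℝ → ℝ) (M X : ℝ) (n : ℕ) : Prop :=
  ∀ u v : ℝ, 0 ≤ v → u + v ≤ X →
    IntegrableOn (fun b => p (u + b) * ∫ a in Set.Iic u, r (a + b) * iterH p r n a b) (Set.Ioc 0 v) ∧
    ∫ b in Set.Ioc 0 v, ‖p (u + b) * ∫ a in Set.Iic u, r (a + b) * iterH p r n a b‖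
      ≤ (cumInt (fun s => |p s|) (u + v) - cumInt (fun s => |p s|) u) *
        (M * cumInt (fun s => |p s|) u / 2 * ((M * incr p u v) ^ n / n.factorial))

lemma outer_of_inner (hp : Measurable p) (hr : Measurable r) (hM0 : 0 ≤ M)
    (hw : ∀ x, IntegrableOn (fun s => |p s|) (Set.Iic x))
    (hS : ∀ x, IntegrableOn (cumInt fun s => |p s|) (Set.Iic x)) (n : ℕ)
    (h : InnerB p r M X n) : OuterB p r M X n := by
  intro u v hv huv
  obtain ⟨hi, he⟩ := outer_int hw u hv
  set C := M * cumInt (fun s => |p s|) u / 2 * ((M * incr p u v) ^ n / n.factorial) with hC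
  have hb : ∀ᵐ b ∂(volume.restrict (Set.Ioc 0 v)),
      ‖p (u + b) * ∫ a in Set.Iic u, r (a + b) * iterH p r n a b‖ ≤ |p (u + b)| * C := by
    filter_upwards [ae_restrict_mem measurableSet_Ioc] with b hb
    rw [norm_mul, Real.norm_eq_abs (p (u + b))]
    refine mul_le_mul_of_nonneg_left ?_ (abs_nonneg _)
    refine (norm_integral_le_integral_norm _).trans ((h u b hb.1.le (by linarith [hb.2])).2.trans ?_)
    have h1 := incr_nonneg hS (u := u) hb.1.le
    have h2 := incr_mono hS (u := u) hb.2
    have h3 := cumInt_nonneg (w := fun s => |p s|) (fun _ => abs_nonneg _) u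
    rw [hC]
    gcongr
  have hI : IntegrableOn (fun b => p (u + b) * ∫ a in Set.Iic u, r (a + b) * iterH p r n a b)
      (Set.Ioc 0 v) := by
    refine Integrable.mono' (hi.mul_const C) ?_ hb
    refine Measurable.aestronglyMeasurable ?_
    exact (hp.comp (by fun_prop)).mul ((iterH_meas hp hr n).2.comp
      (g := fun z : ℝ × ℝ => ∫ a in Set.Iic z.1, r (a + z.2) * iterH p r n a z.2)
      (f := fun b : ℝ => (u, b)) (by fun_prop))
  refine ⟨hI, ?_⟩
  calc _ ≤ ∫ b in Set.Ioc 0 v, |p (u + b)| * C := integral_mono_ae hI.norm (hi.mul_const C) hb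
    _ = _ := by rw [integral_mul_const, he]

lemma iterH_succ_le {n : ℕ} (h : OuterB p r M X n) {u v : ℝ} (hv : 0 ≤ v) (huv : u + v ≤ X) :
    ‖iterH p r (n + 1) u v‖ ≤ (cumInt (fun s => |p s|) (u + v) - cumInt (fun s => |p s|) u) *
        (M * cumInt (fun s => |p s|) u / 2 * ((M * incr p u v) ^ n / n.factorial)) := by
  simp only [iterH]
  exact (norm_integral_le_integral_norm _).trans (h u v hv huv).2

lemma inner_aux (hp : Measurable p) (hr : Measurable r) {n : ℕ} {u v C : ℝ} {g : ℝ → ℝ}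
    (hg : IntegrableOn g (Set.Iic u)) (hC : ∫ a in Set.Iic u, g a ≤ C)
    (hb : ∀ a ≤ u, ‖r (a + v) * iterH p r n a v‖ ≤ g a) :
    IntegrableOn (fun a => r (a + v) * iterH p r n a v) (Set.Iic u) ∧
    ∫ a in Set.Iic u, ‖r (a + v) * iterH p r n a v‖ ≤ C := by
  have hb' : ∀ᵐ a ∂(volume.restrict (Set.Iic u)), ‖r (a + v) * iterH p r n a v‖ ≤ g a := by
    filter_upwards [ae_restrict_mem measurableSet_Iic] with a ha using hb a ha
  have hI : IntegrableOn (fun a => r (a + v) * iterH p r n a v) (Set.Iic u) := by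
    refine Integrable.mono' hg ?_ hb'
    refine Measurable.aestronglyMeasurable ?_
    exact (hr.comp (by fun_prop)).mul ((iterH_meas hp hr n).1.comp
      (g := fun z : ℝ × ℝ => iterH p r n z.1 z.2)
      (f := fun a : ℝ => (a, v)) (by fun_prop))
  exact ⟨hI, (integral_mono_ae hI.norm hg hb').trans hC⟩

lemma inner_all (hp : Measurable p) (hr : Measurable r) (hM0 : 0 ≤ M) (hM : ∀ z ≤ X, |r z| ≤ M)
    (hw : ∀ x, IntegrableOn (fun s => |p s|) (Set.Iic x))
    (hS : ∀ x, IntegrableOn (cumInt fun s => |p s|) (Set.Iic x)) (n : ℕ) :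
    InnerB p r M X n := by
  induction n with
  | zero =>
    intro u v hv huv
    refine inner_aux (g := fun a => M / 2 * |p a|) hp hr ((hw u).const_mul _) ?_ ?_
    · rw [integral_const_mul]
      simp [cumInt]
      linarith
    · intro a ha
      rw [norm_mul]
      have h1 : ‖r (a + v)‖ ≤ M := hM _ (by linarith)
      have h2 : ‖iterH p r 0 a v‖ = |p a| / 2 := by
        simp [iterH]
      rw [h2]
      have := mul_le_mul_of_nonneg_right h1 (by positivity : 0 ≤ |p a| / 2)
      linarith
  | succ n ih =>
    have ho := outer_of_inner hp hr hM0 hw hS n ih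
    intro u v hv huv
    have hSm := cumInt_mono hw (fun _ => abs_nonneg _)
    have hSn := cumInt_nonneg (w := fun s => |p s|) (fun _ => abs_nonneg _)
    obtain ⟨f1, f2⟩ := ftc_step hS (cumInt_cont hw) hSm hv n u
    set K := M * (M * cumInt (fun s => |p s|) u / 2 * (M ^ n / n.factorial)) with hK
    refine inner_aux (g := fun a => K * ((cumInt (fun s => |p s|) (a + v) - cumInt (fun s => |p s|) a) *
      (cumInt (cumInt fun s => |p s|) (a + v) - cumInt (cumInt fun s => |p s|) a) ^ n))
      hp hr (f1.const_mul _) ?_ ?_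
    · rw [integral_const_mul, f2, hK]
      apply le_of_eq
      rw [Nat.factorial_succ]
      unfold incr
      push_cast
      have : (n.factorial : ℝ) ≠ 0 := by positivity
      have : (n : ℝ) + 1 ≠ 0 := by positivity
      field_simp
      rw [mul_pow]
      ring
    · intro a ha
      rw [norm_mul]
      have h1 : ‖r (a + v)‖ ≤ M := hM _ (by linarith)
      have h2 := iterH_succ_le ho (u := a) hv (by linarith)
      have h3 := incr_nonneg hS (u := a) hv
      have h4 := hSm ha
      have h5 : 0 ≤ cumInt (fun s => |p s|) (a + v) - cumInt (fun s => |p s|) a :=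
        sub_nonneg.2 (hSm (by linarith))
      have h6 := hSn a
      calc _ ≤ M * ((cumInt (fun s => |p s|) (a + v) - cumInt (fun s => |p s|) a) *
        (M * cumInt (fun s => |p s|) a / 2 * ((M * incr p a v) ^ n / n.factorial))) := by gcongr
        _ ≤ M * ((cumInt (fun s => |p s|) (a + v) - cumInt (fun s => |p s|) a) *
        (M * cumInt (fun s => |p s|) u / 2 * ((M * incr p a v) ^ n / n.factorial))) := by gcongr
        _ = _ := by rw [hK, mul_pow]; unfold incr; ring

end Bounds

lemma main_abs {p r : ℝ → ℝ} (hp : Measurable p) (hr : Measurable r)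
    (hw : ∀ x, IntegrableOn (fun s => |p s|) (Set.Iic x))
    (hS : ∀ x, IntegrableOn (cumInt fun s => |p s|) (Set.Iic x))
    {M u v : ℝ} (hM0 : 0 ≤ M) (hM : ∀ z ≤ u + v, |r z| ≤ M) (hv : 0 ≤ v) :
    (∑' n, iterH p r n u v = -(p u) / 2 + ∫ b in (0:ℝ)..v,
      p (u + b) * ∫ a in Set.Iic u, r (a + b) * ∑' n, iterH p r n a b) ∧
    |∑' n, iterH p r n u v| ≤ |p u| / 2 + cumInt (fun s => |p s|) u *
      (cumInt (fun s => |p s|) (u + v) - cumInt (fun s => |p s|) u) / 2 * M *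
        Real.exp (M * incr p u v) := by
  have hI := inner_all hp hr hM0 hM hw hS
  have hO := fun n => outer_of_inner hp hr hM0 hw hS n (hI n)
  have hexp : ∀ x : ℝ, HasSum (fun n : ℕ => x ^ n / n.factorial) (Real.exp x) := by
    intro x
    rw [Real.exp_eq_exp_ℝ]
    exact NormedSpace.expSeries_div_hasSum_exp x
  have hbs := ((hexp (M * incr p u v)).mul_left (M * cumInt (fun s => |p s|) u / 2)).mul_left
    (cumInt (fun s => |p s|) (u + v) - cumInt (fun s => |p s|) u)
  have hle : ∀ n, ‖iterH p r (n + 1) u v‖ ≤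
      (cumInt (fun s => |p s|) (u + v) - cumInt (fun s => |p s|) u) *
        (M * cumInt (fun s => |p s|) u / 2 * ((M * incr p u v) ^ n / n.factorial)) := fun n => iterH_succ_le (hO n) hv le_rfl
  have hsum1 : Summable (fun n => iterH p r (n + 1) u v) :=
    Summable.of_norm_bounded hbs.summable hle
  have hsplit : ∑' n, iterH p r n u v = -(p u) / 2 + ∑' n, iterH p r (n + 1) u v := by
    have h0 : Summable (fun n => iterH p r n u v) :=
      (summable_nat_add_iff (f := fun n => iterH p r n u v) 1).1 hsum1
    rw [h0.tsum_eq_zero_add]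
    simp only [iterH]
  have hinner : ∀ b, 0 ≤ b → b ≤ v →
      ∑' n, ∫ a in Set.Iic u, r (a + b) * iterH p r n a b
        = ∫ a in Set.Iic u, r (a + b) * ∑' n, iterH p r n a b := by
    intro b hb hbv
    have hh := fun n => hI n u b hb (by linarith)
    have := hasSum_integral_of_summable_integral_norm (fun n => (hh n).1)
      (Summable.of_nonneg_of_le (fun n => integral_nonneg fun _ => norm_nonneg _)
        (fun n => (hh n).2)
        ((hexp (M * incr p u b)).mul_left (M * cumInt (fun s => |p s|) u / 2)).summable)
    rw [this.tsum_eq]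
    simp_rw [tsum_mul_left]
  constructor
  · rw [hsplit]
    congr 1
    have hh := fun n => hO n u v hv le_rfl
    have := hasSum_integral_of_summable_integral_norm (fun n => (hh n).1)
      (Summable.of_nonneg_of_le (fun n => integral_nonneg fun _ => norm_nonneg _)
        (fun n => (hh n).2) hbs.summable)
    have h2 := this.tsum_eq
    rw [intervalIntegral.integral_of_le hv]
    have h3 : ∀ n, iterH p r (n + 1) u v = ∫ b in Set.Ioc 0 v,
      p (u + b) * ∫ a in Set.Iic u, r (a + b) * iterH p r n a b := fun n => by rw [iterH]
    rw [tsum_congr h3, h2]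
    refine setIntegral_congr_fun measurableSet_Ioc fun b hb => ?_
    rw [tsum_mul_left, hinner b hb.1.le hb.2]
  · rw [hsplit]
    refine (abs_add_le _ _).trans (add_le_add (le_of_eq ?_) ?_)
    · rw [abs_div, abs_neg]; norm_num
    · refine (tsum_of_norm_bounded hbs hle).trans (le_of_eq ?_)
      ring

/-- Left-reflection kernel estimate for the Goursat problem in characteristic variables. -/
theorem left_kernel_estimate (q0 : ℝ → ℝ) (c : ℝ) (hc : 0 < c)
    (hmeas : Measurable q0) (hbdd : ∃ B : ℝ, ∀ x : ℝ, |q0 x| ≤ B)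
    (hlim : Tendsto q0 atBot (nhds c))
    (hint : IntegrableOn (fun x : ℝ => (1 + |x|) * |q0 x - c|) (Set.Iic 0)) :
    ∃ H2 : ℝ → ℝ → ℝ,
      (∀ u v : ℝ, 0 ≤ v →
        H2 u v = -(q0 u - c) / 2 +
          ∫ vv in (0 : ℝ)..v,
            (q0 (u + vv) - c) * ∫ uu in Set.Iic u, (q0 (uu + vv) + c) * H2 uu vv) ∧
      (∀ u v : ℝ, 0 ≤ v →
        |H2 u v| ≤ |q0 u - c| / 2 +
          (∫ s in Set.Iic u, |q0 s - c|) *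
            ((∫ s in Set.Iic (u + v), |q0 s - c|) - ∫ s in Set.Iic u, |q0 s - c|) / 2 *
            (⨆ z ∈ Set.Iic (u + v), |q0 z + c|) *
            Real.exp ((⨆ z ∈ Set.Iic (u + v), |q0 z + c|) *
              ((∫ x in Set.Iic (u + v), ∫ s in Set.Iic x, |q0 s - c|)
                - ∫ x in Set.Iic u, ∫ s in Set.Iic x, |q0 s - c|))) := by
  obtain ⟨B, hB⟩ := hbdd
  have hB0 : 0 ≤ B := (abs_nonneg _).trans (hB 0)
  have hp : Measurable (fun x => q0 x - c) := hmeas.sub_const c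
  have hr : Measurable (fun x => q0 x + c) := hmeas.add_const c
  have hpa : Measurable (fun x => |q0 x - c|) := hp.abs
  have hw0 : IntegrableOn (fun s => |q0 s - c|) (Set.Iic 0) := by
    refine Integrable.mono' hint hpa.aestronglyMeasurable (Eventually.of_forall fun x => ?_)
    rw [Real.norm_eq_abs, abs_abs]
    nlinarith [abs_nonneg x, abs_nonneg (q0 x - c)]
  have h1 : IntegrableOn (fun x => (-x) * |q0 x - c|) (Set.Iic 0) := by
    refine Integrable.mono' hint (measurable_neg.mul hpa).aestronglyMeasurable
      (Eventually.of_forall fun x => ?_)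
    rw [Real.norm_eq_abs, abs_mul, abs_abs, abs_neg]
    nlinarith [abs_nonneg x, abs_nonneg (q0 x - c)]
  have hw : ∀ x, IntegrableOn (fun s => |q0 s - c|) (Set.Iic x) := by
    intro x
    have h2 : IntegrableOn (fun s => |q0 s - c|) (Set.Icc 0 x) := by
      refine Measure.integrableOn_of_bounded (M := B + c) (by simp) hpa.aestronglyMeasurable
        (Eventually.of_forall fun y => ?_)
      rw [Real.norm_eq_abs, abs_abs]
      refine (abs_sub _ _).trans ?_
      rw [abs_of_pos hc]
      linarith [hB y]
    refine (hw0.union h2).mono_set ?_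
    intro y hy
    rcases le_total y 0 with h | h
    · exact Or.inl h
    · exact Or.inr ⟨h, hy⟩
  have hS := cumInt_integrable hpa (fun _ => abs_nonneg _) hw h1
  have hM0 : ∀ X, 0 ≤ ⨆ z ∈ Set.Iic X, |q0 z + c| := fun X =>
    Real.iSup_nonneg fun z => Real.iSup_nonneg fun _ => abs_nonneg _
  have hM : ∀ X, ∀ z ≤ X, |q0 z + c| ≤ ⨆ z ∈ Set.Iic X, |q0 z + c| := by
    intro X z hz
    have hb : ∀ y, |q0 y + c| ≤ B + c := fun y => by
      refine (abs_add_le _ _).trans ?_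
      rw [abs_of_pos hc]
      linarith [hB y]
    refine le_ciSup_of_le ⟨B + c, ?_⟩ z ?_
    · rintro _ ⟨y, rfl⟩
      exact Real.iSup_le (fun _ => hb y) (by linarith)
    · have : Nonempty (z ∈ Set.Iic X) := ⟨hz⟩
      rw [ciSup_const]
  refine ⟨fun u v => ∑' n, iterH (fun x => q0 x - c) (fun x => q0 x + c) n u v, ?_, ?_⟩
  · intro u v hv
    exact (main_abs hp hr hw hS (hM0 (u + v)) (hM (u + v)) hv).1
  · intro u v hv
    exact (main_abs hp hr hw hS (hM0 (u + v)) (hM (u + v)) hv).2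
end
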